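/- arXiv:2302.05389 — 4 statements merged into one kernel-verified Lean document; each statement's English description precedes it below -/
import Mathlib

section
/- (Crouzeix–Palencia) Let Ω ⊆ ℂ be a bounded convex open set and M a bounded linear operator on a complex Hilbert space H such that the closure of the numerical range W(M) is contained in Ω. Then for every polynomial p ∈ ℂ[X], ‖p(M)‖ ≤ (1 + √2) · sup_{z ∈ closure(Ω)} |p(z)|. -/
open scoped InnerProductSpace
open Complex MeasureTheory Set Filter Topology

section BanachAlgebra

variable {A : Type*} [NormedRing A] [NormedAlgebra ℂ A] [CompleteSpace A]

theorem continuousOn_resolvent_comp {X : Type*} [TopologicalSpace X] {s : Set X}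
    {a : X → A} {k : X → ℂ} (ha : ContinuousOn a s) (hk : ContinuousOn k s)
    (h : ∀ x ∈ s, k x ∈ resolventSet ℂ (a x)) :
    ContinuousOn (fun x => resolvent (a x) (k x)) s := by
  intro x hx
  obtain ⟨u, hu⟩ := spectrum.mem_resolventSet_iff.mp (h x hx)
  have h1 : ContinuousAt Ring.inverse (algebraMap ℂ A (k x) - a x) := by
    rw [← hu]; exact NormedRing.inverse_continuousAt u
  have h2 : ContinuousWithinAt (fun y => algebraMap ℂ A (k y) - a y) s x :=
    (((continuous_algebraMap ℂ A).continuousAt.comp_continuousWithinAt (hk x hx)).sub (ha x hx))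
  exact h1.comp_continuousWithinAt (f := fun y => algebraMap ℂ A (k y) - a y) h2

/-- A function with quadratically small increments is constant. -/
theorem eq_of_norm_sub_le_sq {E : Type*} [NormedAddCommGroup E] [NormedSpace ℝ E]
    {G : ℝ → E} {C : ℝ}
    (h : ∀ s ∈ Icc (0 : ℝ) 1, ∀ s' ∈ Icc (0 : ℝ) 1, ‖G s' - G s‖ ≤ C * (s' - s) ^ 2) :
    G 1 = G 0 := by
  have hd : ∀ x ∈ Icc (0 : ℝ) 1, HasDerivWithinAt G 0 (Icc 0 1) x := by
    intro x hx
    rw [hasDerivWithinAt_iff_isLittleO]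
    have h1 : (fun x' => G x' - G x - (x' - x) • (0 : E)) =O[𝓝[Icc 0 1] x]
        fun x' => (x' - x) ^ 2 := by
      refine Asymptotics.IsBigO.of_bound C ?_
      filter_upwards [self_mem_nhdsWithin] with y hy
      simpa using h x hx y hy
    refine h1.trans_isLittleO ?_
    have h2 : (fun x' : ℝ => (x' - x)) =o[𝓝[Icc 0 1] x] fun _ => (1 : ℝ) := by
      rw [Asymptotics.isLittleO_one_iff]
      have : Tendsto (fun x' : ℝ => x' - x) (𝓝 x) (𝓝 (x - x)) := by
        apply Continuous.tendsto; fun_prop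
      rw [sub_self] at this
      exact this.mono_left nhdsWithin_le_nhds
    simpa [sq] using (Asymptotics.isBigO_refl (fun x' : ℝ => x' - x) _).mul_isLittleO h2
  refine constant_of_derivWithin_zero (fun x hx => (hd x hx).differentiableWithinAt) ?_ 1 (by simp)
  intro x hx
  exact (hd x ⟨hx.1, hx.2.le⟩).derivWithin (uniqueDiffOn_Icc zero_lt_one x ⟨hx.1, hx.2.le⟩)

theorem resolvent_smul_sub {A : Type*} [NormedRing A] [NormedAlgebra ℂ A] {b : A} {k s s' : ℂ}
    (hs : k ∈ resolventSet ℂ (s • b)) (hs' : k ∈ resolventSet ℂ (s' • b)) :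
    resolvent (s' • b) k - resolvent (s • b) k - (s' - s) • (b * resolvent (s • b) k ^ 2) =
      (s' - s) ^ 2 • (resolvent (s • b) k * b * resolvent (s • b) k * b * resolvent (s' • b) k) := by
  obtain ⟨u, hu⟩ := spectrum.mem_resolventSet_iff.mp hs
  obtain ⟨v, hv⟩ := spectrum.mem_resolventSet_iff.mp hs'
  have hR : resolvent (s • b) k = ↑u⁻¹ := by rw [resolvent, ← hu, Ring.inverse_unit]
  have hR' : resolvent (s' • b) k = ↑v⁻¹ := by rw [resolvent, ← hv, Ring.inverse_unit]
  rw [hR, hR']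
  have key : (↑v⁻¹ : A) - ↑u⁻¹ = (s' - s) • (↑u⁻¹ * b * ↑v⁻¹) := by
    have : (↑v⁻¹ : A) - ↑u⁻¹ = ↑u⁻¹ * (↑u - ↑v) * ↑v⁻¹ := by
      rw [mul_sub, sub_mul]; simp [mul_assoc]
    rw [this, hu, hv]
    rw [show algebraMap ℂ A k - s • b - (algebraMap ℂ A k - s' • b) = (s' - s) • b by
      rw [sub_smul]; abel]
    simp
  have hcomm : b * (↑u⁻¹ : A) = ↑u⁻¹ * b := by
    have : Commute b (u : A) := by
      rw [hu]
      exact Commute.sub_right (Algebra.commutes k b).symm ((Commute.refl b).smul_right s)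
    exact (this.units_inv_right).eq
  have e1 : b * (↑u⁻¹ : A) ^ 2 = ↑u⁻¹ * b * ↑u⁻¹ := by rw [sq, ← mul_assoc, hcomm]
  rw [key, e1, ← smul_sub, ← mul_sub, key]
  simp [smul_smul, sq, mul_assoc]

theorem hasDerivAt_resolvent_comp {a : A} {τ : ℝ → ℂ} {τ' : ℂ} {t : ℝ}
    (h : τ t ∈ resolventSet ℂ a) (hτ : HasDerivAt τ τ' t) :
    HasDerivAt (fun t => resolvent a (τ t)) (-(τ' • resolvent a (τ t) ^ 2)) t := by
  have := (spectrum.hasDerivAt_resolvent_const_left (a := a) h).scomp t hτ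
  simpa [Function.comp_def] using! this

/-- A closed curve avoiding the spectra of all `s • b`, `s ∈ [0, 1]`, winds around `b`
as often as around `0`. -/
theorem integral_smul_resolvent_homotopy {b : A} {τ τ' : ℝ → ℂ} {L : ℝ} (hL : 0 ≤ L)
    (hτ : ∀ t, HasDerivAt τ (τ' t) t) (hτ' : Continuous τ') (hclosed : τ L = τ 0)
    (h : ∀ s ∈ Icc (0 : ℝ) 1, ∀ t, τ t ∈ resolventSet ℂ ((s : ℂ) • b)) :
    ∫ t in (0 : ℝ)..L, τ' t • resolvent b (τ t) =
      ∫ t in (0 : ℝ)..L, τ' t • resolvent (0 : A) (τ t) := by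
  have hτc : Continuous τ := continuous_iff_continuousAt.2 fun t => (hτ t).continuousAt
  set R : ℝ → ℝ → A := fun s t => resolvent ((s : ℂ) • b) (τ t) with hR
  have hRc : ContinuousOn (fun q : ℝ × ℝ => R q.1 q.2) (Icc 0 1 ×ˢ univ) := by
    apply continuousOn_resolvent_comp
    · fun_prop
    · fun_prop
    · rintro ⟨s, t⟩ ⟨hs, -⟩
      exact h s hs t
  have hRs : ∀ s ∈ Icc (0 : ℝ) 1, Continuous (R s) := fun s hs => by
    rw [← continuousOn_univ]
    exact hRc.comp (f := fun t : ℝ => (s, t)) (by fun_prop) (fun t _ => ⟨hs, trivial⟩)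
  obtain ⟨C, hC⟩ := (isCompact_Icc.prod (isCompact_Icc (a := (0 : ℝ)) (b := L))).exists_bound_of_continuousOn
    (hRc.mono (Set.prod_mono le_rfl (subset_univ _)))
  have hC0 : 0 ≤ C := (norm_nonneg _).trans (hC (0, 0) ⟨by simp, by simp [hL]⟩)
  obtain ⟨C', hC'⟩ := (isCompact_Icc (a := (0 : ℝ)) (b := L)).exists_bound_of_continuousOn
    hτ'.continuousOn
  have hC0' : 0 ≤ C' := (norm_nonneg _).trans (hC' 0 (by simp [hL]))
  have hzero : ∀ s ∈ Icc (0 : ℝ) 1, ∫ t in (0 : ℝ)..L, τ' t • R s t ^ 2 = 0 := by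
    intro s hs
    have := intervalIntegral.integral_eq_sub_of_hasDerivAt (a := 0) (b := L)
      (fun t _ => hasDerivAt_resolvent_comp (h s hs t) (hτ t))
      (Continuous.intervalIntegrable (by
        have := hRs s hs
        simp only [hR] at this
        fun_prop) _ _)
    rw [hclosed, sub_self, intervalIntegral.integral_neg, neg_eq_zero] at this
    exact this
  have main := eq_of_norm_sub_le_sq (G := fun s => ∫ t in (0 : ℝ)..L, τ' t • R s t)
    (C := C' * (C * ‖b‖ * C * ‖b‖ * C) * L) (fun s hs s' hs' => ?_)
  · simpa [hR] using main
  · have c1 := hRs s hs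
    have c2 := hRs s' hs'
    have e1 : (∫ t in (0 : ℝ)..L, τ' t • R s' t) - ∫ t in (0 : ℝ)..L, τ' t • R s t =
        ∫ t in (0 : ℝ)..L, τ' t • (R s' t - R s t - ((s' : ℂ) - s) • (b * R s t ^ 2)) := by
      have e2 : ∫ t in (0 : ℝ)..L, ((s' : ℂ) - s) • (b * (τ' t • R s t ^ 2)) = 0 := by
        have : Continuous fun t => τ' t • R s t ^ 2 := by fun_prop
        rw [intervalIntegral.integral_smul]
        have := (ContinuousLinearMap.mul ℂ A b).intervalIntegral_comp_comm
          (this.intervalIntegrable (μ := volume) 0 L)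
        simp only [ContinuousLinearMap.mul_apply'] at this
        rw [this, hzero s hs]; simp
      rw [← sub_zero ((∫ t in (0 : ℝ)..L, τ' t • R s' t) - ∫ t in (0 : ℝ)..L, τ' t • R s t), ← e2,
        ← intervalIntegral.integral_sub, ← intervalIntegral.integral_sub]
      · congr 1; ext t; simp only [smul_sub, mul_smul_comm, smul_comm (τ' t)]
      all_goals exact Continuous.intervalIntegrable (by fun_prop) _ _
    rw [e1]
    refine (intervalIntegral.norm_integral_le_of_norm_le_const
      (C := C' * (C * ‖b‖ * C * ‖b‖ * C) * (s' - s) ^ 2) ?_).trans (le_of_eq ?_)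
    · intro t ht
      rw [uIoc_of_le hL] at ht
      have ht' : t ∈ Icc 0 L := ⟨ht.1.le, ht.2⟩
      rw [resolvent_smul_sub (h s hs t) (h s' hs' t), norm_smul, norm_smul, mul_assoc C']
      have n1 : ‖((s' : ℂ) - s) ^ 2‖ = (s' - s) ^ 2 := by
        rw [norm_pow, ← ofReal_sub, norm_real, Real.norm_eq_abs, sq_abs]
      rw [n1, mul_comm ((s' - s) ^ 2)]
      have k1 : ‖R s t‖ ≤ C := hC (s, t) ⟨hs, ht'⟩
      have k2 : ‖R s' t‖ ≤ C := hC (s', t) ⟨hs', ht'⟩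
      gcongr
      · exact hC' t ht'
      · refine (norm_mul_le _ _).trans ?_
        gcongr
        refine (norm_mul_le _ _).trans ?_
        gcongr
        refine (norm_mul_le _ _).trans ?_
        gcongr
        refine (norm_mul_le _ _).trans ?_
        gcongr
    · rw [sub_zero, abs_of_nonneg hL]; ring

/-- Cauchy's integral formula for polynomials in a Banach algebra. -/
theorem integral_smul_resolvent_polynomial {a : A} {τ τ' : ℝ → ℂ} {L : ℝ} {w : ℂ}
    (hτ : ∀ t, HasDerivAt τ (τ' t) t) (hτ' : Continuous τ') (hclosed : τ L = τ 0)
    (h : ∀ t, τ t ∈ resolventSet ℂ a)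
    (h1 : ∫ t in (0 : ℝ)..L, τ' t • resolvent a (τ t) = w • (1 : A)) (p : Polynomial ℂ) :
    ∫ t in (0 : ℝ)..L, (p.eval (τ t) * τ' t) • resolvent a (τ t) = w • Polynomial.aeval a p := by
  have hτc : Continuous τ := continuous_iff_continuousAt.2 fun t => (hτ t).continuousAt
  have hRc : Continuous fun t => resolvent a (τ t) := by
    rw [← continuousOn_univ]
    exact continuousOn_resolvent_comp (by fun_prop) (by fun_prop) (fun t _ => h t)
  have hmon : ∀ n : ℕ, ∫ t in (0 : ℝ)..L, (τ t ^ n * τ' t) • resolvent a (τ t) = w • a ^ n := by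
    intro n
    induction n with
    | zero => simpa using h1
    | succ n ih =>
      have e : ∀ t, (τ t ^ (n + 1) * τ' t) • resolvent a (τ t) =
          (τ t ^ n * τ' t) • (1 : A) + a * ((τ t ^ n * τ' t) • resolvent a (τ t)) := by
        intro t
        obtain ⟨u, hu⟩ := spectrum.mem_resolventSet_iff.mp (h t)
        have hR : resolvent a (τ t) = ↑u⁻¹ := by rw [resolvent, ← hu, Ring.inverse_unit]
        have : τ t • (↑u⁻¹ : A) = 1 + a * ↑u⁻¹ := by
          have := u.mul_inv
          rw [hu, sub_mul, ← Algebra.smul_def] at this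
          rw [← this]; abel
        rw [hR, mul_smul_comm, ← smul_add, ← this, smul_smul]; ring_nf
      simp_rw [e]
      rw [intervalIntegral.integral_add]
      · have c : Continuous fun t => (τ t ^ n * τ' t) • resolvent a (τ t) := by fun_prop
        have := (ContinuousLinearMap.mul ℂ A a).intervalIntegral_comp_comm
          (c.intervalIntegrable (μ := volume) 0 L)
        simp only [ContinuousLinearMap.mul_apply'] at this
        rw [this, ih, intervalIntegral.integral_smul_const]
        have hd : ∀ t, HasDerivAt (fun t => τ t ^ (n + 1) / (n + 1)) (τ t ^ n * τ' t) t := by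
          intro t
          have := ((hτ t).pow (n + 1)).div_const ((n : ℂ) + 1)
          have hn : (n : ℂ) + 1 ≠ 0 := by exact_mod_cast n.succ_ne_zero
          have hval : ((n + 1 : ℕ) : ℂ) * τ t ^ (n + 1 - 1) * τ' t / ((n : ℂ) + 1) =
              τ t ^ n * τ' t := by
            rw [div_eq_iff hn, Nat.add_sub_cancel]; push_cast; ring
          rw [hval] at this
          exact this
        rw [intervalIntegral.integral_eq_sub_of_hasDerivAt (fun t _ => hd t)
          (Continuous.intervalIntegrable (by fun_prop) _ _), hclosed]
        simp [pow_succ']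
      all_goals exact Continuous.intervalIntegrable (by fun_prop) _ _
  induction p using Polynomial.induction_on' with
  | add p q hp hq =>
    simp only [Polynomial.eval_add, map_add, add_mul, add_smul, smul_add]
    rw [intervalIntegral.integral_add, hp, hq]
    all_goals exact Continuous.intervalIntegrable (by fun_prop) _ _
  | monomial n c =>
    simp only [Polynomial.eval_monomial, Polynomial.aeval_monomial, mul_assoc, mul_smul c]
    rw [intervalIntegral.integral_smul, hmon, ← Algebra.smul_def, smul_comm]

end BanachAlgebra

/-- The real part of `z` in the direction `exp (i t)`. -/
noncomputable def dirRe (t : ℝ) (z : ℂ) : ℝ := (exp (-(t * I)) * z).re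

theorem dirRe_eq (t : ℝ) (z : ℂ) : dirRe t z = Real.cos t * z.re + Real.sin t * z.im := by
  simp [dirRe, ← neg_mul, ← ofReal_neg, exp_ofReal_mul_I_re, exp_ofReal_mul_I_im]
  ring

theorem dirRe_add (t : ℝ) (z w : ℂ) : dirRe t (z + w) = dirRe t z + dirRe t w := by
  simp [dirRe_eq]; ring

theorem dirRe_sub (t : ℝ) (z w : ℂ) : dirRe t (z - w) = dirRe t z - dirRe t w := by
  simp [dirRe_eq]; ring

theorem dirRe_real_mul (t r : ℝ) (z : ℂ) : dirRe t (r * z) = r * dirRe t z := by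
  simp [dirRe_eq]; ring

theorem dirRe_le_norm (t : ℝ) (z : ℂ) : dirRe t z ≤ ‖z‖ := by
  refine (re_le_norm _).trans ?_
  rw [norm_mul, ← neg_mul, ← ofReal_neg, norm_exp_ofReal_mul_I, one_mul]

theorem continuous_dirRe : Continuous fun q : ℝ × ℂ => dirRe q.1 q.2 := by
  unfold dirRe; fun_prop

theorem dirRe_periodic (z : ℂ) : Function.Periodic (fun t => dirRe t z) (2 * Real.pi) := by
  intro t; simp [dirRe_eq]

/-- A `C²` periodic function `h` with `h + h'' ≥ 0`: the support function of a planar convex body,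
together with its first two derivatives. -/
structure SmoothSupport where
  h : ℝ → ℝ
  h' : ℝ → ℝ
  h'' : ℝ → ℝ
  hasDerivAt_h : ∀ t, HasDerivAt h (h' t) t
  hasDerivAt_h' : ∀ t, HasDerivAt h' (h'' t) t
  continuous_h'' : Continuous h''
  periodic_h : Function.Periodic h (2 * Real.pi)
  nonneg : ∀ t, 0 ≤ h t + h'' t

namespace SmoothSupport

variable (S : SmoothSupport)

theorem continuous_h : Continuous S.h :=
  continuous_iff_continuousAt.2 fun t => (S.hasDerivAt_h t).continuousAt

theorem continuous_h' : Continuous S.h' :=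
  continuous_iff_continuousAt.2 fun t => (S.hasDerivAt_h' t).continuousAt

theorem periodic_h' : Function.Periodic S.h' (2 * Real.pi) := by
  intro t
  have h1 := (S.hasDerivAt_h (t + 2 * Real.pi)).comp_add_const t (2 * Real.pi)
  have : (fun x => S.h (x + 2 * Real.pi)) = S.h := funext S.periodic_h
  rw [this] at h1
  exact h1.unique (S.hasDerivAt_h t)

/-- The boundary curve, parametrised by the direction of the outer normal. -/
noncomputable def curve (t : ℝ) : ℂ := exp (t * I) * (S.h t + S.h' t * I)

/-- The velocity of the boundary curve. -/
noncomputable def velocity (t : ℝ) : ℂ := I * exp (t * I) * ((S.h t + S.h'' t : ℝ) : ℂ)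

/-- The convex body with support function `h`. -/
def region : Set ℂ := {z | ∀ t, dirRe t z ≤ S.h t}

theorem hasDerivAt_curve (t : ℝ) : HasDerivAt S.curve (S.velocity t) t := by
  have h1 : HasDerivAt (fun t : ℝ => exp (t * I)) (exp (t * I) * (1 * I)) t :=
    ((hasDerivAt_id t).ofReal_comp.mul_const I).cexp
  have h2 := (S.hasDerivAt_h t).ofReal_comp.add ((S.hasDerivAt_h' t).ofReal_comp.mul_const I)
  have h3 := h1.mul h2
  refine h3.congr_deriv ?_
  simp only [velocity, Pi.add_apply]
  push_cast
  linear_combination exp (t * I) * S.h' t * I_mul_I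

theorem continuous_curve : Continuous S.curve :=
  continuous_iff_continuousAt.2 fun t => (S.hasDerivAt_curve t).continuousAt

theorem continuous_velocity : Continuous S.velocity := by
  have := S.continuous_h
  have := S.continuous_h''
  unfold velocity
  fun_prop

theorem curve_periodic : Function.Periodic S.curve (2 * Real.pi) := by
  intro t
  simp only [curve, S.periodic_h t, S.periodic_h' t]
  push_cast
  rw [add_mul, exp_periodic]

theorem exp_neg_mul_curve (t : ℝ) : exp (-(t * I)) * S.curve t = S.h t + S.h' t * I := by
  rw [curve, ← mul_assoc, ← exp_add]; simp

theorem dirRe_curve_self (t : ℝ) : dirRe t (S.curve t) = S.h t := by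
  rw [dirRe, exp_neg_mul_curve]; simp

theorem dirRe_curve_le (s t : ℝ) : dirRe s (S.curve t) ≤ S.h s := by
  set w : ℝ → ℝ := fun t => dirRe s (S.curve t) with hw
  have hper : Function.Periodic w (2 * Real.pi) := fun t => by simp only [hw, S.curve_periodic t]
  have hd : ∀ t, HasDerivAt w (-Real.sin (t - s) * (S.h t + S.h'' t)) t := by
    intro t
    have h1 := ((S.hasDerivAt_curve t).const_mul (exp (-(s * I))))
    have h2 := (reCLM.hasFDerivAt.comp_hasDerivAt t h1)
    refine h2.congr_deriv ?_
    have : exp (-(s * I)) * S.velocity t =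
        I * exp ((t - s : ℝ) * I) * ((S.h t + S.h'' t : ℝ) : ℂ) := by
      rw [velocity]; push_cast; rw [sub_mul, sub_eq_add_neg, exp_add]; ring
    rw [reCLM_apply, this, re_mul_ofReal, mul_re, exp_ofReal_mul_I_re, exp_ofReal_mul_I_im]
    simp
  have hc : Continuous w := continuous_iff_continuousAt.2 fun t => (hd t).continuousAt
  have hmono : MonotoneOn w (Icc (s - Real.pi) s) := by
    refine monotoneOn_of_deriv_nonneg (convex_Icc _ _) hc.continuousOn
      (fun t _ => (hd t).differentiableAt.differentiableWithinAt) ?_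
    intro t ht
    rw [interior_Icc] at ht
    rw [(hd t).deriv]
    refine mul_nonneg ?_ (S.nonneg t)
    rw [neg_nonneg]
    exact Real.sin_nonpos_of_nonpos_of_neg_pi_le (by linarith [ht.2]) (by linarith [ht.1])
  have hanti : AntitoneOn w (Icc s (s + Real.pi)) := by
    refine antitoneOn_of_deriv_nonpos (convex_Icc _ _) hc.continuousOn
      (fun t _ => (hd t).differentiableAt.differentiableWithinAt) ?_
    intro t ht
    rw [interior_Icc] at ht
    rw [(hd t).deriv]
    have h1 := Real.sin_nonneg_of_nonneg_of_le_pi (x := t - s)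
      (by linarith [ht.1]) (by linarith [ht.2])
    have := mul_nonneg h1 (S.nonneg t)
    linarith
  have hs : w s = S.h s := S.dirRe_curve_self s
  obtain ⟨y, hy, hty⟩ := hper.exists_mem_Ico Real.two_pi_pos t (s - Real.pi)
  change w t ≤ S.h s
  rw [hty, ← hs]
  rcases le_total y s with h | h
  · exact hmono ⟨hy.1, h⟩ ⟨by linarith [Real.pi_pos], le_rfl⟩ h
  · exact hanti ⟨le_rfl, by linarith [Real.pi_pos]⟩ ⟨h, by linarith [hy.2]⟩ h

theorem curve_mem_region (t : ℝ) : S.curve t ∈ S.region := fun s => S.dirRe_curve_le s t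

theorem isClosed_region : IsClosed S.region := by
  have : S.region = ⋂ t, {z | dirRe t z ≤ S.h t} := by ext; simp [region]
  rw [this]
  refine isClosed_iInter fun t => isClosed_le ?_ continuous_const
  exact continuous_dirRe.comp (f := fun z : ℂ => (t, z)) (by fun_prop)

theorem isBounded_region : Bornology.IsBounded S.region := by
  rw [isBounded_iff_forall_norm_le]
  refine ⟨(|S.h 0| + |S.h Real.pi|) + (|S.h (Real.pi / 2)| + |S.h (-(Real.pi / 2))|),
    fun z hz => ?_⟩
  refine (norm_le_abs_re_add_abs_im z).trans ?_
  have h1 := hz 0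
  have h2 := hz Real.pi
  have h3 := hz (Real.pi / 2)
  have h4 := hz (-(Real.pi / 2))
  simp [dirRe_eq] at h1 h2 h3 h4
  refine add_le_add (abs_le.2 ⟨?_, ?_⟩) (abs_le.2 ⟨?_, ?_⟩) <;>
  linarith [le_abs_self (S.h 0), le_abs_self (S.h Real.pi), le_abs_self (S.h (Real.pi / 2)),
    le_abs_self (S.h (-(Real.pi / 2))), abs_nonneg (S.h 0), abs_nonneg (S.h Real.pi),
    abs_nonneg (S.h (Real.pi / 2)), abs_nonneg (S.h (-(Real.pi / 2)))]

theorem isCompact_region : IsCompact S.region :=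
  Metric.isCompact_of_isClosed_isBounded S.isClosed_region S.isBounded_region

section Interior

variable {S} {z : ℂ} (hz : ∀ t, dirRe t z < S.h t)

include hz

theorem exists_gap : ∃ m > 0, ∀ t, dirRe t z + m ≤ S.h t := by
  have hc : Continuous fun t => S.h t - dirRe t z :=
    S.continuous_h.sub (continuous_dirRe.comp (f := fun t : ℝ => (t, z)) (by fun_prop))
  have hp : Function.Periodic (fun t => S.h t - dirRe t z) (2 * Real.pi) :=
    S.periodic_h.sub (dirRe_periodic z)
  obtain ⟨t₀, -, ht₀⟩ := isCompact_Icc.exists_isMinOn (s := Icc 0 (0 + 2 * Real.pi))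
    (nonempty_Icc.2 (by linarith [Real.pi_pos])) hc.continuousOn
  refine ⟨S.h t₀ - dirRe t₀ z, by linarith [hz t₀], fun t => ?_⟩
  obtain ⟨y, hy, hty⟩ := hp.exists_mem_Ico Real.two_pi_pos t 0
  have h1 : S.h t₀ - dirRe t₀ z ≤ S.h y - dirRe y z := ht₀ ⟨hy.1, hy.2.le⟩
  have h2 : S.h t - dirRe t z = S.h y - dirRe y z := hty
  linarith

theorem re_exp_neg_mul_pos (t : ℝ) : 0 < (exp (-(t * I)) * (S.curve t - z)).re := by
  have : dirRe t (S.curve t - z) = S.h t - dirRe t z := by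
    rw [dirRe_sub, dirRe_curve_self]
  rw [dirRe] at this
  rw [this]
  linarith [hz t]

theorem curve_sub_ne_zero (t : ℝ) : S.curve t - z ≠ 0 := by
  intro h
  have := re_exp_neg_mul_pos hz t
  simp [h] at this

theorem continuous_velocity_div : Continuous fun t => S.velocity t / (S.curve t - z) :=
  S.continuous_velocity.div (S.continuous_curve.sub continuous_const) (curve_sub_ne_zero hz)

omit hz in
variable (S z) in
/-- A continuous logarithm of `curve t - z`. -/
noncomputable def logLift (t : ℝ) : ℂ := log (exp (-(t * I)) * (S.curve t - z)) + t * I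

theorem exp_logLift (t : ℝ) : exp (S.logLift z t) = S.curve t - z := by
  rw [logLift, exp_add, exp_log, mul_right_comm, ← exp_add]
  · simp
  · exact mul_ne_zero (exp_ne_zero _) (curve_sub_ne_zero hz t)

theorem hasDerivAt_logLift (t : ℝ) :
    HasDerivAt (S.logLift z) (S.velocity t / (S.curve t - z)) t := by
  have h0 := curve_sub_ne_zero hz t
  have h1 : HasDerivAt (fun t : ℝ => exp (-(t * I))) (exp (-(t * I)) * (-(1 * I))) t :=
    ((hasDerivAt_id t).ofReal_comp.mul_const I).neg.cexp
  have h2 := (h1.mul ((S.hasDerivAt_curve t).sub_const z)).clog_real (Or.inl (re_exp_neg_mul_pos hz t))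
  have h3 := h2.add ((hasDerivAt_id t).ofReal_comp.mul_const I)
  refine h3.congr_deriv ?_
  have := exp_ne_zero (-(t * I))
  simp only [ofReal_one, Pi.mul_apply]
  field_simp
  ring

omit hz in
theorem logLift_two_pi : S.logLift z (2 * Real.pi) = S.logLift z 0 + 2 * Real.pi * I := by
  have h1 := S.curve_periodic 0
  rw [zero_add] at h1
  rw [logLift, logLift, h1]
  push_cast
  rw [exp_neg, exp_two_pi_mul_I]; simp

theorem integral_velocity_div :
    ∫ t in (0 : ℝ)..(2 * Real.pi), S.velocity t / (S.curve t - z) = 2 * Real.pi * I := by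
  rw [intervalIntegral.integral_eq_sub_of_hasDerivAt (fun t _ => hasDerivAt_logLift hz t)
    ((continuous_velocity_div hz).intervalIntegrable _ _), logLift_two_pi]
  ring

theorem im_velocity_div_nonneg (t : ℝ) : 0 ≤ (S.velocity t / (S.curve t - z)).im := by
  have h1 : S.velocity t / (S.curve t - z) =
      I * (exp (-(t * I)) * (S.curve t - z))⁻¹ * ((S.h t + S.h'' t : ℝ) : ℂ) := by
    rw [velocity, mul_inv, ← exp_neg, neg_neg]; ring
  rw [h1, im_mul_ofReal, I_mul_im, inv_re]
  exact mul_nonneg (div_nonneg (re_exp_neg_mul_pos hz t).le (normSq_nonneg _)) (S.nonneg t)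

theorem integral_eval_velocity_div (p : Polynomial ℂ) :
    ∫ t in (0 : ℝ)..(2 * Real.pi), p.eval (S.curve t) * (S.velocity t / (S.curve t - z)) =
      2 * Real.pi * I * p.eval z := by
  have hr : ∀ t, resolvent z (S.curve t) = (S.curve t - z)⁻¹ := fun t => by
    simp [resolvent]
  have := integral_smul_resolvent_polynomial (a := z) (w := 2 * Real.pi * I)
    S.hasDerivAt_curve S.continuous_velocity (by simpa using S.curve_periodic 0)
    (fun t => spectrum.mem_resolventSet_iff.2 (by simpa using curve_sub_ne_zero hz t))
    (by simpa [hr, div_eq_mul_inv] using integral_velocity_div hz) p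
  simpa [hr, div_eq_mul_inv, mul_assoc] using this

theorem integral_comp_logLift_im {ψ : ℝ → ℝ} (hψ : Continuous ψ)
    (hper : Function.Periodic ψ (2 * Real.pi)) :
    ∫ t in (0 : ℝ)..(2 * Real.pi), ψ (S.logLift z t).im * (S.velocity t / (S.curve t - z)).im =
      ∫ t in (0 : ℝ)..(2 * Real.pi), ψ t := by
  have hd : ∀ t, HasDerivAt (fun t => (S.logLift z t).im)
      (S.velocity t / (S.curve t - z)).im t := fun t =>
    imCLM.hasFDerivAt.comp_hasDerivAt t (hasDerivAt_logLift hz t)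
  have h1 := intervalIntegral.integral_comp_mul_deriv (a := 0) (b := 2 * Real.pi) (g := ψ)
    (fun t _ => hd t) (continuous_im.comp (continuous_velocity_div hz)).continuousOn hψ
  simp only [Function.comp_apply] at h1
  rw [h1, logLift_two_pi]
  have h2 : (S.logLift z 0 + 2 * Real.pi * I).im = (S.logLift z 0).im + 2 * Real.pi := by simp
  rw [h2, hper.intervalIntegral_add_eq _ 0, zero_add]

theorem continuous_logLift : Continuous (S.logLift z) :=
  continuous_iff_continuousAt.2 fun t => (hasDerivAt_logLift hz t).continuousAt

/-- The direction from `z` to a boundary point makes a large angle with the normal of a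
supporting line close to `z`, unless the boundary point is itself close to `z`. -/
theorem norm_mul_cos_logLift_le (s t : ℝ) :
    ‖S.curve t - z‖ * Real.cos ((S.logLift z t).im - s) ≤ S.h s - dirRe s z := by
  have h1 : dirRe s (S.curve t - z) = ‖S.curve t - z‖ * Real.cos ((S.logLift z t).im - s) := by
    rw [dirRe, ← exp_logLift hz t, ← exp_add, exp_re, norm_exp]
    simp [sub_eq_add_neg, add_comm]
  rw [← h1, dirRe_sub]
  linarith [S.dirRe_curve_le s t]

end Interior

end SmoothSupport

/-- A continuous approximation of the indicator function of `(-∞, 0]`. -/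
noncomputable def cutoff (κ x : ℝ) : ℝ := max 0 (min 1 (2 - x / κ))

theorem cutoff_nonneg (κ x : ℝ) : 0 ≤ cutoff κ x := le_max_left _ _

theorem cutoff_le_one (κ x : ℝ) : cutoff κ x ≤ 1 := max_le zero_le_one (min_le_left _ _)

theorem cutoff_eq_one {κ x : ℝ} (hκ : 0 < κ) (h : x ≤ κ) : cutoff κ x = 1 := by
  have : x / κ ≤ 1 := (div_le_one hκ).2 h
  rw [cutoff, min_eq_left (by linarith), max_eq_right zero_le_one]

theorem cutoff_eq_zero {κ x : ℝ} (hκ : 0 < κ) (h : 2 * κ ≤ x) : cutoff κ x = 0 := by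
  have : 2 ≤ x / κ := (le_div_iff₀ hκ).2 h
  rw [cutoff, max_eq_left]
  exact (min_le_right _ _).trans (by linarith)

theorem continuous_cutoff (κ : ℝ) : Continuous (cutoff κ) := by
  unfold cutoff; fun_prop

theorem exists_integral_cutoff_cos {ε : ℝ} (hε : 0 < ε) :
    ∃ κ > 0, |(∫ t in (0 : ℝ)..(2 * Real.pi), cutoff κ (Real.cos t)) - Real.pi| ≤ ε := by
  have hπ := Real.pi_pos
  set K : ℕ → ℝ := fun n => 1 / ((n : ℝ) + 1) with hK
  have hK0 : ∀ n, 0 < K n := fun n => Nat.one_div_pos_of_nat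
  have hcont : ∀ n, Continuous fun t => cutoff (K n) (Real.cos t) := fun n =>
    (continuous_cutoff _).comp Real.continuous_cos
  have hsplit : ∀ n, ∫ t in (0 : ℝ)..(2 * Real.pi), cutoff (K n) (Real.cos t) =
      (∫ t in (-(Real.pi / 2))..(Real.pi / 2), cutoff (K n) (Real.cos t)) + Real.pi := by
    intro n
    have hp : Function.Periodic (fun t => cutoff (K n) (Real.cos t)) (2 * Real.pi) := fun t => by
      simp
    have h1 := hp.intervalIntegral_add_eq 0 (-(Real.pi / 2))
    rw [zero_add] at h1
    rw [h1, ← intervalIntegral.integral_add_adjacent_intervals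
      ((hcont n).intervalIntegrable _ (Real.pi / 2)) ((hcont n).intervalIntegrable _ _)]
    congr 1
    have h2 : ∀ t ∈ uIcc (Real.pi / 2) (-(Real.pi / 2) + 2 * Real.pi),
        cutoff (K n) (Real.cos t) = 1 := by
      intro t ht
      rw [uIcc_of_le (by linarith)] at ht
      refine cutoff_eq_one (hK0 n) ((Real.cos_nonpos_of_pi_div_two_le_of_le ht.1 ?_).trans
        (hK0 n).le)
      linarith [ht.2]
    rw [intervalIntegral.integral_congr h2]
    simp; ring
  have hlim : Tendsto (fun n => ∫ t in (-(Real.pi / 2))..(Real.pi / 2), cutoff (K n) (Real.cos t))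
      atTop (𝓝 (∫ t in (-(Real.pi / 2))..(Real.pi / 2), (0 : ℝ))) := by
    refine intervalIntegral.tendsto_integral_filter_of_dominated_convergence (fun _ => 1) ?_ ?_ ?_ ?_
    · exact Eventually.of_forall fun n => (hcont n).aestronglyMeasurable
    · refine Eventually.of_forall fun n => Eventually.of_forall fun t _ => ?_
      rw [Real.norm_eq_abs, abs_of_nonneg (cutoff_nonneg _ _)]
      exact cutoff_le_one _ _
    · exact intervalIntegrable_const
    · have : ∀ᵐ t : ℝ, t ≠ Real.pi / 2 := by simp [ae_iff]
      filter_upwards [this] with t ht htI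
      rw [uIoc_of_le (by linarith)] at htI
      have hcos : 0 < Real.cos t :=
        Real.cos_pos_of_mem_Ioo ⟨htI.1, lt_of_le_of_ne htI.2 ht⟩
      have h0 : Tendsto (fun n => 2 * K n) atTop (𝓝 (2 * 0)) :=
        tendsto_one_div_add_atTop_nhds_zero_nat.const_mul 2
      rw [mul_zero] at h0
      refine tendsto_const_nhds.congr' ?_
      filter_upwards [h0.eventually (ge_mem_nhds hcos)] with n hn
      exact (cutoff_eq_zero (hK0 n) hn).symm
  rw [intervalIntegral.integral_zero] at hlim
  obtain ⟨n, hn⟩ := (Metric.tendsto_atTop.1 hlim ε hε)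
  refine ⟨K n, hK0 n, ?_⟩
  rw [hsplit n, add_sub_cancel_right]
  simpa [Real.dist_eq] using (hn n le_rfl).le

namespace SmoothSupport

variable (S : SmoothSupport)

/-- The Cauchy transform of the complex conjugate of a polynomial. -/
noncomputable def conjCauchy (p : Polynomial ℂ) (z : ℂ) : ℂ :=
  (2 * Real.pi * I)⁻¹ * ∫ t in (0 : ℝ)..(2 * Real.pi),
    (starRingEnd ℂ) (p.eval (S.curve t)) * (S.velocity t / (S.curve t - z))

variable {S}

theorem conjCauchy_add_conj {z : ℂ} (hz : ∀ t, dirRe t z < S.h t) (p : Polynomial ℂ) :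
    Real.pi * (S.conjCauchy p z + (starRingEnd ℂ) (p.eval z)) =
      ∫ t in (0 : ℝ)..(2 * Real.pi), (starRingEnd ℂ) (p.eval (S.curve t)) *
        ((S.velocity t / (S.curve t - z)).im : ℂ) := by
  have hw := continuous_velocity_div hz
  have hp : Continuous fun t => p.eval (S.curve t) := p.continuous.comp S.continuous_curve
  set w := fun t => S.velocity t / (S.curve t - z) with hw_def
  have h1 := congrArg (starRingEnd ℂ) (integral_eval_velocity_div hz p)
  have h2 : (starRingEnd ℂ) (∫ t in (0 : ℝ)..(2 * Real.pi), p.eval (S.curve t) * w t) =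
      ∫ t in (0 : ℝ)..(2 * Real.pi), (starRingEnd ℂ) (p.eval (S.curve t) * w t) :=
    ((conjCLE : ℂ →L[ℝ] ℂ).intervalIntegral_comp_comm
      ((hp.mul hw).intervalIntegrable (μ := volume) 0 (2 * Real.pi))).symm
  rw [h2] at h1
  have h3 : ∀ t, (starRingEnd ℂ) (p.eval (S.curve t)) * ((w t).im : ℂ) =
      (2 * I)⁻¹ * ((starRingEnd ℂ) (p.eval (S.curve t)) * w t -
        (starRingEnd ℂ) (p.eval (S.curve t) * w t)) := by
    intro t
    have := sub_conj (w t)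
    rw [map_mul, ← mul_sub, this]
    field_simp
    push_cast
    ring
  change _ = ∫ t in (0 : ℝ)..(2 * Real.pi), (starRingEnd ℂ) (p.eval (S.curve t)) * ((w t).im : ℂ)
  have h4 : S.conjCauchy p z = (2 * Real.pi * I)⁻¹ * ∫ t in (0 : ℝ)..(2 * Real.pi),
      (starRingEnd ℂ) (p.eval (S.curve t)) * w t := rfl
  simp_rw [h3]
  rw [intervalIntegral.integral_const_mul, intervalIntegral.integral_sub, h1, h4]
  · simp only [map_mul, conj_I, conj_ofReal, map_ofNat]
    have : (Real.pi : ℂ) ≠ 0 := by exact_mod_cast Real.pi_ne_zero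
    field_simp
    ring
  · exact Continuous.intervalIntegrable (by fun_prop) _ _
  · exact Continuous.intervalIntegrable (by fun_prop) _ _

theorem norm_conjCauchy_le {p : Polynomial ℂ} {B ε : ℝ} (hε : 0 < ε)
    (hB : ∀ z ∈ S.region, ‖p.eval z‖ ≤ B) :
    ∃ d > 0, ∀ z, (∀ t, dirRe t z < S.h t) → ∀ s, S.h s - dirRe s z ≤ d →
      ‖S.conjCauchy p z‖ ≤ B + ε := by
  have hπ := Real.pi_pos
  have hB0 : 0 ≤ B := (norm_nonneg _).trans (hB _ (S.curve_mem_region 0))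
  obtain ⟨κ, hκ, hI⟩ := exists_integral_cutoff_cos (ε := ε * Real.pi / (4 * (B + 1)))
    (by positivity)
  set J := ∫ t in (0 : ℝ)..(2 * Real.pi), cutoff κ (Real.cos t) with hJ
  obtain ⟨η, hη, hunif⟩ := Metric.uniformContinuousOn_iff.1
    (S.isCompact_region.uniformContinuousOn_of_continuous p.continuous.continuousOn) (ε / 4)
    (by positivity)
  refine ⟨κ * η / 2, by positivity, fun z hz s hs => ?_⟩
  have hzr : z ∈ S.region := fun t => (hz t).le
  have hw := continuous_velocity_div hz
  have hL := continuous_logLift hz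
  have hp : Continuous fun t => p.eval (S.curve t) := p.continuous.comp S.continuous_curve
  set a : ℝ → ℝ := fun t => (S.velocity t / (S.curve t - z)).im with ha
  have hac : Continuous a := continuous_im.comp hw
  have ha0 : ∀ t, 0 ≤ a t := im_velocity_div_nonneg hz
  set F : ℝ → ℂ := fun t => (starRingEnd ℂ) (p.eval (S.curve t)) with hF
  have hFc : Continuous F := by fun_prop
  set q : ℂ := (starRingEnd ℂ) (p.eval z) with hq
  set ψ : ℝ → ℝ := fun t => cutoff κ (Real.cos ((S.logLift z t).im - s)) with hψ
  have hψc : Continuous ψ := (continuous_cutoff κ).comp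
    (Real.continuous_cos.comp ((continuous_im.comp hL).sub continuous_const))
  have hψ0 : ∀ t, 0 ≤ ψ t := fun t => cutoff_nonneg _ _
  have hψ1 : ∀ t, ψ t ≤ 1 := fun t => cutoff_le_one _ _
  have hψa : ∫ t in (0 : ℝ)..(2 * Real.pi), ψ t * a t = J := by
    have hp' : Function.Periodic (fun t => cutoff κ (Real.cos t)) (2 * Real.pi) := fun t => by simp
    have := integral_comp_logLift_im hz (ψ := fun t => cutoff κ (Real.cos (t - s)))
      ((continuous_cutoff κ).comp (by fun_prop)) (hp'.sub_const s)
    rw [this, intervalIntegral.integral_comp_sub_right (fun t => cutoff κ (Real.cos t)), hJ]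
    have h2 := hp'.intervalIntegral_add_eq (0 - s) 0
    rw [zero_add] at h2
    rw [← h2]; ring_nf
  have hone : ∫ t in (0 : ℝ)..(2 * Real.pi), a t = 2 * Real.pi := by
    have := integral_comp_logLift_im hz (ψ := fun _ => 1) continuous_const (fun _ => rfl)
    simpa using this
  have near : ∀ t, ‖((1 - ψ t : ℝ) : ℂ) * (F t - q) * (a t : ℂ)‖ ≤ ε / 4 * a t := by
    intro t
    rw [norm_mul, norm_real, Real.norm_eq_abs, abs_of_nonneg (ha0 t)]
    refine mul_le_mul_of_nonneg_right ?_ (ha0 t)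
    rw [norm_mul, norm_real, Real.norm_eq_abs, abs_of_nonneg (by linarith [hψ1 t])]
    by_cases hc : Real.cos ((S.logLift z t).im - s) ≤ κ
    · have : ψ t = 1 := cutoff_eq_one hκ hc
      rw [this]; simp; positivity
    · push Not at hc
      have h1 := norm_mul_cos_logLift_le hz s t
      have h2 : ‖S.curve t - z‖ * κ ≤ κ * η / 2 :=
        (mul_le_mul_of_nonneg_left hc.le (norm_nonneg _)).trans (h1.trans hs)
      have h3 : ‖S.curve t - z‖ < η := by nlinarith
      have h4 := hunif _ (S.curve_mem_region t) _ hzr (by rwa [dist_eq_norm])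
      rw [dist_eq_norm] at h4
      have h5 : ‖F t - q‖ ≤ ε / 4 := by
        rw [hF, hq, ← map_sub, RCLike.norm_conj]; exact h4.le
      nlinarith [hψ0 t, hψ1 t, norm_nonneg (F t - q)]
  have e := conjCauchy_add_conj hz p
  have b1 : ‖∫ t in (0 : ℝ)..(2 * Real.pi), (ψ t : ℂ) * F t * (a t : ℂ)‖ ≤ B * J := by
    rw [← hψa, ← intervalIntegral.integral_const_mul]
    refine intervalIntegral.norm_integral_le_of_norm_le (by positivity)
      (Eventually.of_forall fun t _ => ?_) (Continuous.intervalIntegrable (by fun_prop) _ _)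
    rw [norm_mul, norm_mul, norm_real, norm_real, Real.norm_eq_abs, Real.norm_eq_abs,
      abs_of_nonneg (ha0 t), abs_of_nonneg (hψ0 t)]
    have : ‖F t‖ ≤ B := by
      rw [hF, RCLike.norm_conj]; exact hB _ (S.curve_mem_region t)
    have := mul_le_mul_of_nonneg_left this (mul_nonneg (hψ0 t) (ha0 t))
    linarith
  have b2 : ‖∫ t in (0 : ℝ)..(2 * Real.pi), ((1 - ψ t : ℝ) : ℂ) * (F t - q) * (a t : ℂ)‖ ≤
      ε / 4 * (2 * Real.pi) := by
    have : ε / 4 * (2 * Real.pi) = ∫ t in (0 : ℝ)..(2 * Real.pi), ε / 4 * a t := by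
      rw [intervalIntegral.integral_const_mul, hone]
    rw [this]
    exact intervalIntegral.norm_integral_le_of_norm_le (by positivity)
      (Eventually.of_forall fun t _ => near t) (Continuous.intervalIntegrable (by fun_prop) _ _)
  have e2 : ∫ t in (0 : ℝ)..(2 * Real.pi), F t * (a t : ℂ) =
      (∫ t in (0 : ℝ)..(2 * Real.pi), (ψ t : ℂ) * F t * (a t : ℂ)) +
      (∫ t in (0 : ℝ)..(2 * Real.pi), ((1 - ψ t : ℝ) : ℂ) * (F t - q) * (a t : ℂ)) +
      q * ((2 * Real.pi - J : ℝ) : ℂ) := by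
    have e3 : q * ((2 * Real.pi - J : ℝ) : ℂ) =
        ∫ t in (0 : ℝ)..(2 * Real.pi), q * ((a t - ψ t * a t : ℝ) : ℂ) := by
      rw [intervalIntegral.integral_const_mul, intervalIntegral.integral_ofReal,
        intervalIntegral.integral_sub, hone, hψa]
      all_goals exact Continuous.intervalIntegrable (by fun_prop) _ _
    rw [e3, ← intervalIntegral.integral_add, ← intervalIntegral.integral_add]
    · congr 1; ext t; push_cast; ring
    all_goals exact Continuous.intervalIntegrable (by fun_prop) _ _
  have e4 : Real.pi * S.conjCauchy p z =
      (∫ t in (0 : ℝ)..(2 * Real.pi), (ψ t : ℂ) * F t * (a t : ℂ)) +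
      (∫ t in (0 : ℝ)..(2 * Real.pi), ((1 - ψ t : ℝ) : ℂ) * (F t - q) * (a t : ℂ)) +
      q * ((Real.pi - J : ℝ) : ℂ) := by
    have : Real.pi * S.conjCauchy p z =
      (∫ t in (0 : ℝ)..(2 * Real.pi), F t * (a t : ℂ)) - Real.pi * q := by
      rw [← e]; ring
    rw [this, e2]; push_cast; ring
  have b3 : ‖q * ((Real.pi - J : ℝ) : ℂ)‖ ≤ B * (ε * Real.pi / (4 * (B + 1))) := by
    rw [norm_mul, norm_real, Real.norm_eq_abs, abs_sub_comm]
    refine mul_le_mul ?_ hI (abs_nonneg _) hB0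
    rw [hq, RCLike.norm_conj]; exact hB z hzr
  have b4 : Real.pi * ‖S.conjCauchy p z‖ ≤ B * J + ε / 4 * (2 * Real.pi) +
      B * (ε * Real.pi / (4 * (B + 1))) := by
    have : Real.pi * ‖S.conjCauchy p z‖ = ‖Real.pi * S.conjCauchy p z‖ := by
      rw [norm_mul, norm_real, Real.norm_eq_abs, abs_of_pos hπ]
    rw [this, e4]
    exact norm_add_le_of_le (norm_add_le_of_le b1 b2) b3
  have b5 : B * (ε * Real.pi / (4 * (B + 1))) ≤ ε * Real.pi / 4 := by
    rw [mul_div_assoc', div_le_div_iff₀ (by positivity) (by positivity)]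
    have : 0 < ε * Real.pi := by positivity
    nlinarith
  have b6 : B * J ≤ B * Real.pi + B * (ε * Real.pi / (4 * (B + 1))) := by
    rw [← mul_add]
    exact mul_le_mul_of_nonneg_left (by linarith [(abs_le.1 hI).2]) hB0
  have : Real.pi * ‖S.conjCauchy p z‖ ≤ Real.pi * (B + ε) := by linarith
  exact le_of_mul_le_mul_left this hπ

end SmoothSupport

section Accretive

variable {H : Type*} [NormedAddCommGroup H] [InnerProductSpace ℂ H]

theorem inner_self_eq_ofReal_norm_sq (x : H) : ⟪x, x⟫_ℂ = ((‖x‖ ^ 2 : ℝ) : ℂ) := by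
  rw [inner_self_eq_norm_sq_to_K, ofReal_pow]; rfl

theorem norm_smul_one_sub_le {T : H →L[ℂ] H} {m R : ℝ} (hm : 0 < m) (hR : m ≤ R)
    (hT : ∀ x, m * ‖x‖ ^ 2 ≤ (⟪x, T x⟫_ℂ).re) (hTR : ‖T‖ ^ 2 ≤ R * m) :
    ‖(R : ℂ) • (1 : H →L[ℂ] H) - T‖ ≤ R - m / 2 := by
  refine ContinuousLinearMap.opNorm_le_bound _ (by linarith) fun x => ?_
  refine abs_le_of_sq_le_sq' ?_ (mul_nonneg (by linarith) (norm_nonneg x)) |>.2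
  have h1 : ((R : ℂ) • (1 : H →L[ℂ] H) - T) x = (R : ℂ) • x - T x := by simp
  have h2 : ‖T x‖ ^ 2 ≤ R * m * ‖x‖ ^ 2 := by
    calc ‖T x‖ ^ 2 ≤ (‖T‖ * ‖x‖) ^ 2 := by gcongr; exact T.le_opNorm x
      _ = ‖T‖ ^ 2 * ‖x‖ ^ 2 := by ring
      _ ≤ _ := by gcongr
  rw [h1, norm_sub_sq (𝕜 := ℂ), inner_smul_left, norm_smul, norm_real, Real.norm_eq_abs,
    abs_of_pos (hm.trans_le hR), conj_ofReal]
  have h3 : RCLike.re ((R : ℂ) * ⟪x, T x⟫_ℂ) = R * (⟪x, T x⟫_ℂ).re := by simp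
  rw [h3]
  have h4 := mul_le_mul_of_nonneg_left (hT x) (hm.trans_le hR).le
  have h5 := mul_nonneg (sq_nonneg (m / 2)) (sq_nonneg ‖x‖)
  nlinarith

theorem norm_sub_le_of_le_re {z : ℂ} {m R : ℝ} (hm : 0 < m) (hR : m ≤ R)
    (hz : m ≤ z.re) (hzR : ‖z‖ ^ 2 ≤ R * m) : ‖(R : ℂ) - z‖ ≤ R - m / 2 := by
  refine abs_le_of_sq_le_sq' ?_ (by linarith) |>.2
  have h1 : ‖(R : ℂ) - z‖ ^ 2 = R ^ 2 - 2 * (R * z.re) + ‖z‖ ^ 2 := by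
    rw [Complex.sq_norm, Complex.sq_norm, normSq_apply, normSq_apply]; simp; ring
  rw [h1]
  have h4 := mul_le_mul_of_nonneg_left hz (hm.trans_le hR).le
  nlinarith [sq_nonneg (m / 2)]

theorem isUnit_of_norm_smul_one_sub_lt {A : Type*} [NormedRing A] [NormedAlgebra ℂ A]
    [CompleteSpace A] {T : A} {R : ℝ} (h : ‖(R : ℂ) • (1 : A) - T‖ < R) : IsUnit T := by
  have hR : 0 < R := (norm_nonneg _).trans_lt h
  have hR' : (R : ℂ) ≠ 0 := by exact_mod_cast hR.ne'
  have h1 : ‖(1 : A) - (R : ℂ)⁻¹ • T‖ < 1 := by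
    have : (1 : A) - (R : ℂ)⁻¹ • T = (R : ℂ)⁻¹ • ((R : ℂ) • (1 : A) - T) := by
      rw [smul_sub, smul_smul, inv_mul_cancel₀ hR', one_smul]
    rw [this, norm_smul, norm_inv, norm_real, Real.norm_eq_abs, abs_of_pos hR,
      inv_mul_lt_iff₀ hR, mul_one]
    exact h
  have h2 := isUnit_one_sub_of_norm_lt_one h1
  rw [sub_sub_cancel] at h2
  have h3 := h2.smul (Units.mk0 (R : ℂ) hR')
  rwa [Units.smul_def, Units.val_mk0, smul_smul, mul_inv_cancel₀ hR', one_smul] at h3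

theorem norm_le_of_norm_inner_le [CompleteSpace H] {T : H →L[ℂ] H} {B : ℝ} (hB : 0 ≤ B)
    (h : ∀ x y, ‖⟪y, T x⟫_ℂ‖ ≤ B * (‖x‖ ^ 2 + ‖y‖ ^ 2)) : ‖T‖ ≤ 2 * B := by
  refine ContinuousLinearMap.opNorm_le_bound _ (by positivity) fun x => ?_
  by_cases hTx : ‖T x‖ = 0
  · rw [hTx]; positivity
  have hTx' : 0 < ‖T x‖ := lt_of_le_of_ne (norm_nonneg _) (Ne.symm hTx)
  have hx : 0 < ‖x‖ := by
    rw [norm_pos_iff]; rintro rfl; simp at hTx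
  have h1 := h x (((‖x‖ / ‖T x‖ : ℝ) : ℂ) • T x)
  rw [inner_smul_left, conj_ofReal, inner_self_eq_norm_sq_to_K, norm_mul, norm_smul, norm_pow] at h1
  simp only [norm_real, Real.norm_eq_abs, coe_algebraMap, abs_norm] at h1
  rw [abs_of_pos (by positivity), div_mul_cancel₀ _ hTx] at h1
  have h2 : ‖x‖ / ‖T x‖ * ‖T x‖ ^ 2 = ‖x‖ * ‖T x‖ := by field_simp
  rw [h2] at h1
  have : ‖x‖ * ‖T x‖ ≤ ‖x‖ * (2 * B * ‖x‖) := by linarith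
  exact le_of_mul_le_mul_left this hx

/-- A weak form of the Cauchy–Schwarz inequality for the real part of an accretive operator. -/
theorem norm_inner_add_inner_le {Q : H →L[ℂ] H} (hQ : ∀ x, 0 ≤ (⟪x, Q x⟫_ℂ).re) (x y : H) :
    ‖⟪y, Q x⟫_ℂ + ⟪Q y, x⟫_ℂ‖ ≤ (⟪x, Q x⟫_ℂ).re + (⟪y, Q y⟫_ℂ).re := by
  set s := ⟪y, Q x⟫_ℂ + ⟪Q y, x⟫_ℂ with hs
  obtain ⟨c, hc, hcs⟩ : ∃ c : ℂ, ‖c‖ = 1 ∧ c * s = ‖s‖ := by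
    by_cases h0 : s = 0
    · exact ⟨1, by simp, by simp [h0]⟩
    · have h1 : (‖s‖ : ℂ) ≠ 0 := by exact_mod_cast (norm_pos_iff.2 h0).ne'
      refine ⟨(starRingEnd ℂ) s / ‖s‖, ?_, ?_⟩
      · rw [norm_div, RCLike.norm_conj, norm_real, norm_norm, div_self]
        exact (norm_pos_iff.2 h0).ne'
      · rw [div_mul_eq_mul_div, mul_comm, mul_conj, normSq_eq_norm_sq, div_eq_iff h1]
        push_cast; ring
  have h := hQ (y - c • x)
  have hcc : (starRingEnd ℂ) c * c = 1 := by
    rw [mul_comm, mul_conj, normSq_eq_norm_sq, hc]; simp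
  have e : ⟪y - c • x, Q (y - c • x)⟫_ℂ = ⟪y, Q y⟫_ℂ + ⟪x, Q x⟫_ℂ
      - (c * ⟪y, Q x⟫_ℂ + (starRingEnd ℂ) c * ⟪x, Q y⟫_ℂ) := by
    simp only [map_sub, map_smul, inner_sub_left, inner_sub_right, inner_smul_left,
      inner_smul_right]
    linear_combination ⟪x, Q x⟫_ℂ * hcc
  have e2 : ((starRingEnd ℂ) c * ⟪x, Q y⟫_ℂ).re = (c * ⟪Q y, x⟫_ℂ).re := by
    rw [← inner_conj_symm x (Q y), ← map_mul, conj_re]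
  have e3 : (c * ⟪y, Q x⟫_ℂ).re + (c * ⟪Q y, x⟫_ℂ).re = ‖s‖ := by
    rw [← add_re, ← mul_add, ← hs, hcs, ofReal_re]
  rw [e, sub_re, add_re, add_re, e2, e3] at h
  linarith

end Accretive

namespace SmoothSupport

variable {S : SmoothSupport} {H : Type*} [NormedAddCommGroup H] [InnerProductSpace ℂ H]

variable (S) in
/-- The numerical range of `M` lies at distance at least `m` inside all supporting lines. -/
def OpGap (M : H →L[ℂ] H) (m : ℝ) : Prop :=
  ∀ t x, dirRe t ⟪x, M x⟫_ℂ + m * ‖x‖ ^ 2 ≤ S.h t * ‖x‖ ^ 2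

theorem OpGap.le_re_inner {M : H →L[ℂ] H} {m : ℝ} (hM : S.OpGap M m) (t : ℝ) (x : H) :
    m * ‖x‖ ^ 2 ≤
      (⟪x, (exp (-(t * I)) • (algebraMap ℂ (H →L[ℂ] H) (S.curve t) - M)) x⟫_ℂ).re := by
  have h1 : ⟪x, (exp (-(t * I)) • (algebraMap ℂ (H →L[ℂ] H) (S.curve t) - M)) x⟫_ℂ =
      ((‖x‖ ^ 2 : ℝ) : ℂ) * (exp (-(t * I)) * S.curve t) - exp (-(t * I)) * ⟪x, M x⟫_ℂ := by
    simp only [Algebra.algebraMap_eq_smul_one, smul_apply,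
      sub_apply, one_apply_eq_self, inner_smul_right,
      inner_sub_right, inner_self_eq_ofReal_norm_sq]
    push_cast; ring
  have h2 := hM t x
  rw [h1, sub_re, re_ofReal_mul, exp_neg_mul_curve]
  simp only [dirRe] at h2
  have h3 : ((S.h t : ℂ) + S.h' t * I).re = S.h t := by simp
  rw [h3]
  linarith

theorem OpGap.homotopy {M : H →L[ℂ] H} {m : ℝ} (hM : S.OpGap M m) {z : ℂ}
    (hz : ∀ t, dirRe t z + m ≤ S.h t) {s : ℝ} (hs : s ∈ Icc (0 : ℝ) 1) :
    S.OpGap (algebraMap ℂ (H →L[ℂ] H) z + (s : ℂ) • (M - algebraMap ℂ _ z)) m := by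
  intro t x
  have h1 : ⟪x, (algebraMap ℂ (H →L[ℂ] H) z + (s : ℂ) • (M - algebraMap ℂ _ z)) x⟫_ℂ =
      (((1 - s) * ‖x‖ ^ 2 : ℝ) : ℂ) * z + (s : ℂ) * ⟪x, M x⟫_ℂ := by
    simp only [Algebra.algebraMap_eq_smul_one, smul_apply,
      sub_apply, add_apply, one_apply_eq_self, inner_smul_right,
      inner_sub_right, inner_add_right, inner_self_eq_ofReal_norm_sq]
    push_cast; ring
  rw [h1, dirRe_add, dirRe_real_mul, dirRe_real_mul]
  have h2 := mul_le_mul_of_nonneg_left (hM t x) hs.1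
  have h3 := mul_le_mul_of_nonneg_left (hz t)
    (mul_nonneg (sub_nonneg.2 hs.2) (sq_nonneg ‖x‖))
  nlinarith

variable [CompleteSpace H]

theorem OpGap.mem_resolventSet {M : H →L[ℂ] H} {m : ℝ} (hm : 0 < m) (hM : S.OpGap M m) (t : ℝ) :
    S.curve t ∈ resolventSet ℂ M := by
  set T := exp (-(t * I)) • (algebraMap ℂ (H →L[ℂ] H) (S.curve t) - M) with hT
  have h1 : IsUnit T := by
    have := norm_smul_one_sub_le (T := T) (R := max m (‖T‖ ^ 2 / m)) hm (le_max_left _ _)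
      (hM.le_re_inner t) ((div_le_iff₀ hm).1 (le_max_right _ _))
    exact isUnit_of_norm_smul_one_sub_lt (this.trans_lt (by linarith))
  rw [spectrum.mem_resolventSet_iff]
  have h2 := h1.smul (Units.mk0 (exp (t * I)) (exp_ne_zero _))
  rwa [Units.smul_def, Units.val_mk0, hT, smul_smul, ← exp_add, add_neg_cancel, exp_zero,
    one_smul] at h2

theorem OpGap.re_inner_resolvent_nonneg {M : H →L[ℂ] H} {m : ℝ} (hm : 0 < m) (hM : S.OpGap M m)
    (t : ℝ) (x : H) :
    0 ≤ (⟪x, ((-I * S.velocity t) • resolvent M (S.curve t)) x⟫_ℂ).re := by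
  obtain ⟨u, hu⟩ := spectrum.mem_resolventSet_iff.mp (hM.mem_resolventSet hm t)
  have hR : resolvent M (S.curve t) = ↑u⁻¹ := by rw [resolvent, ← hu, Ring.inverse_unit]
  set v := exp (t * I) • (↑u⁻¹ : H →L[ℂ] H) x with hv
  have hx : (exp (-(t * I)) • (algebraMap ℂ (H →L[ℂ] H) (S.curve t) - M)) v = x := by
    rw [← hu, hv, smul_apply, map_smul, smul_smul, ← exp_add,
      neg_add_cancel, exp_zero, one_smul]
    change ((u : H →L[ℂ] H) * ↑u⁻¹) x = x
    simp
  have h1 := hM.le_re_inner t v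
  rw [hx] at h1
  have h2 : -I * S.velocity t = ((S.h t + S.h'' t : ℝ) : ℂ) * exp (t * I) := by
    rw [velocity]; linear_combination -exp (t * I) * ((S.h t + S.h'' t : ℝ) : ℂ) * I_mul_I
  rw [hR, h2, mul_smul, smul_apply, smul_apply, ← hv,
    inner_smul_right, re_ofReal_mul]
  refine mul_nonneg (S.nonneg t) ?_
  rw [← inner_conj_symm, conj_re]
  exact (mul_nonneg hm.le (sq_nonneg _)).trans h1

theorem OpGap.continuous_resolvent {M : H →L[ℂ] H} {m : ℝ} (hm : 0 < m) (hM : S.OpGap M m) :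
    Continuous fun t => resolvent M (S.curve t) := by
  rw [← continuousOn_univ]
  exact continuousOn_resolvent_comp continuousOn_const S.continuous_curve.continuousOn
    fun t _ => hM.mem_resolventSet hm t

theorem OpGap.integral_resolvent {M : H →L[ℂ] H} {m : ℝ} (hm : 0 < m) (hM : S.OpGap M m)
    {z : ℂ} (hz : ∀ t, dirRe t z + m ≤ S.h t) :
    ∫ t in (0 : ℝ)..(2 * Real.pi), S.velocity t • resolvent M (S.curve t) =
      (2 * Real.pi * I) • (1 : H →L[ℂ] H) := by
  set b := M - algebraMap ℂ (H →L[ℂ] H) z with hb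
  have hz' : ∀ t, dirRe t z < S.h t := fun t => by linarith [hz t]
  have h1 : ∀ t, resolvent b (S.curve t - z) = resolvent M (S.curve t) := fun t => by
    rw [resolvent, resolvent, hb, map_sub, sub_sub_sub_cancel_right]
  have h2 := integral_smul_resolvent_homotopy (b := b) (L := 2 * Real.pi) Real.two_pi_pos.le
    (fun t => (S.hasDerivAt_curve t).sub_const z) S.continuous_velocity
    (by simpa using S.curve_periodic 0) (fun s hs t => by
      have := (hM.homotopy hz hs).mem_resolventSet hm t
      rw [spectrum.mem_resolventSet_iff] at this ⊢
      rwa [map_sub, sub_sub])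
  simp_rw [h1] at h2
  rw [h2]
  have h3 : ∀ t, S.velocity t • resolvent (0 : H →L[ℂ] H) (S.curve t - z) =
      (S.velocity t / (S.curve t - z)) • (1 : H →L[ℂ] H) := fun t => by
    have h0 := curve_sub_ne_zero hz' t
    have h4 : algebraMap ℂ (H →L[ℂ] H) (S.curve t - z) - 0 =
        ↑(Units.map (algebraMap ℂ (H →L[ℂ] H)).toMonoidHom (Units.mk0 _ h0)) := by simp
    rw [resolvent, h4, Ring.inverse_unit, ← map_inv, div_eq_mul_inv, mul_smul]
    simp [Algebra.algebraMap_eq_smul_one]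
  simp_rw [h3]
  rw [intervalIntegral.integral_smul_const, integral_velocity_div hz']

variable (S) in
/-- The Cauchy transform of the conjugate of a polynomial, evaluated at an operator. -/
noncomputable def opConjCauchy (p : Polynomial ℂ) (M : H →L[ℂ] H) : H →L[ℂ] H :=
  (2 * Real.pi * I)⁻¹ • ∫ t in (0 : ℝ)..(2 * Real.pi),
    ((starRingEnd ℂ) (p.eval (S.curve t)) * S.velocity t) • resolvent M (S.curve t)

theorem inner_integral_apply {F : ℝ → H →L[ℂ] H} (hF : Continuous F) (a b : ℝ) (x y : H) :
    ⟪y, (∫ t in a..b, F t) x⟫_ℂ = ∫ t in a..b, ⟪y, F t x⟫_ℂ :=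
  (((innerSL ℂ y).comp (ContinuousLinearMap.apply ℂ H x)).intervalIntegral_comp_comm
    (hF.intervalIntegrable (μ := volume) a b)).symm

theorem OpGap.norm_aeval_add_adjoint_le {M : H →L[ℂ] H} {m : ℝ} (hm : 0 < m) (hM : S.OpGap M m)
    {z : ℂ} (hz : ∀ t, dirRe t z + m ≤ S.h t) {p : Polynomial ℂ} {B : ℝ}
    (hB : ∀ z ∈ S.region, ‖p.eval z‖ ≤ B) :
    ‖Polynomial.aeval M p + (S.opConjCauchy p M).adjoint‖ ≤ 2 * B := by
  have hπ := Real.pi_pos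
  have hπ' : (Real.pi : ℂ) ≠ 0 := by exact_mod_cast hπ.ne'
  have hB0 : 0 ≤ B := (norm_nonneg _).trans (hB _ (S.curve_mem_region 0))
  have hRc := hM.continuous_resolvent hm
  have hvc := S.continuous_velocity
  have hpc : Continuous fun t => p.eval (S.curve t) := p.continuous.comp S.continuous_curve
  set Q : ℝ → H →L[ℂ] H := fun t => (-I * S.velocity t) • resolvent M (S.curve t) with hQ
  have hQc : Continuous Q := by fun_prop
  have hQ0 : ∀ t x, 0 ≤ (⟪x, Q t x⟫_ℂ).re := hM.re_inner_resolvent_nonneg hm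
  have hQ1 : ∫ t in (0 : ℝ)..(2 * Real.pi), Q t = (2 * Real.pi : ℂ) • (1 : H →L[ℂ] H) := by
    simp only [hQ, mul_smul]
    rw [intervalIntegral.integral_smul, hM.integral_resolvent hm hz, smul_smul]
    have : -I * (2 * Real.pi * I) = 2 * Real.pi := by linear_combination -2 * Real.pi * I_mul_I
    rw [this, mul_smul]
  have hre_int : ∀ x, ∫ t in (0 : ℝ)..(2 * Real.pi), (⟪x, Q t x⟫_ℂ).re =
      2 * Real.pi * ‖x‖ ^ 2 := by
    intro x
    have h1 := inner_integral_apply hQc 0 (2 * Real.pi) x x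
    have h2 := reCLM.intervalIntegral_comp_comm (μ := volume) (a := 0) (b := 2 * Real.pi)
      (f := fun t => ⟪x, Q t x⟫_ℂ) (Continuous.intervalIntegrable (by fun_prop) _ _)
    simp only [reCLM_apply] at h2
    rw [h2, ← h1, hQ1, smul_apply, inner_smul_right,
      one_apply_eq_self, inner_self_eq_norm_sq_to_K]
    have : (2 * Real.pi : ℂ) * ((‖x‖ : ℝ) : ℂ) ^ 2 = ((2 * Real.pi * ‖x‖ ^ 2 : ℝ) : ℂ) := by
      push_cast; ring
    exact (congrArg re this).trans (ofReal_re _)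
  have hp1 : (2 * Real.pi : ℂ) • Polynomial.aeval M p =
      ∫ t in (0 : ℝ)..(2 * Real.pi), p.eval (S.curve t) • Q t := by
    have h1 := integral_smul_resolvent_polynomial S.hasDerivAt_curve S.continuous_velocity
      (by simpa using S.curve_periodic 0) (hM.mem_resolventSet hm) (hM.integral_resolvent hm hz) p
    have h2 : ∀ t, p.eval (S.curve t) • Q t =
        (-I) • ((p.eval (S.curve t) * S.velocity t) • resolvent M (S.curve t)) := fun t => by
      simp only [hQ, smul_smul]; congr 1; ring
    simp_rw [h2]
    rw [intervalIntegral.integral_smul, h1, smul_smul]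
    have : -I * (2 * Real.pi * I) = 2 * Real.pi := by linear_combination -2 * Real.pi * I_mul_I
    rw [this]
  have hp2 : (2 * Real.pi : ℂ) • S.opConjCauchy p M =
      ∫ t in (0 : ℝ)..(2 * Real.pi), (starRingEnd ℂ) (p.eval (S.curve t)) • Q t := by
    have h2 : ∀ t, (starRingEnd ℂ) (p.eval (S.curve t)) • Q t =
        (-I) • (((starRingEnd ℂ) (p.eval (S.curve t)) * S.velocity t) •
          resolvent M (S.curve t)) := fun t => by
      simp only [hQ, smul_smul]; congr 1; ring
    simp_rw [h2]
    rw [intervalIntegral.integral_smul, opConjCauchy, smul_smul]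
    congr 1
    rw [mul_inv, mul_inv, inv_I]
    field_simp
  refine norm_le_of_norm_inner_le hB0 fun x y => ?_
  have hconj : Continuous fun t => (starRingEnd ℂ) (p.eval (S.curve t)) := by fun_prop
  have e1 : (2 * Real.pi : ℂ) * ⟪y, Polynomial.aeval M p x⟫_ℂ =
      ∫ t in (0 : ℝ)..(2 * Real.pi), p.eval (S.curve t) * ⟪y, Q t x⟫_ℂ := by
    rw [← inner_smul_right, ← smul_apply, hp1,
      inner_integral_apply (by fun_prop)]
    simp only [smul_apply, inner_smul_right]
  have e2 : (2 * Real.pi : ℂ) * ⟪y, (S.opConjCauchy p M).adjoint x⟫_ℂ =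
      ∫ t in (0 : ℝ)..(2 * Real.pi), p.eval (S.curve t) * ⟪Q t y, x⟫_ℂ := by
    have h1 : (2 * Real.pi : ℂ) * ⟪x, S.opConjCauchy p M y⟫_ℂ =
        ∫ t in (0 : ℝ)..(2 * Real.pi), (starRingEnd ℂ) (p.eval (S.curve t)) * ⟪x, Q t y⟫_ℂ := by
      rw [← inner_smul_right, ← smul_apply, hp2,
        inner_integral_apply (by fun_prop)]
      simp only [smul_apply, inner_smul_right]
    have h2 := congrArg (starRingEnd ℂ) h1
    have h3 := ((conjCLE : ℂ →L[ℝ] ℂ).intervalIntegral_comp_comm (μ := volume)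
      (a := 0) (b := 2 * Real.pi)
      (f := fun t => (starRingEnd ℂ) (p.eval (S.curve t)) * ⟪x, Q t y⟫_ℂ)
      (Continuous.intervalIntegrable (by fun_prop) _ _))
    simp only [ContinuousLinearEquiv.coe_coe, conjCLE_apply] at h3
    rw [← h3] at h2
    simp only [map_mul, conj_ofReal, map_ofNat, inner_conj_symm, conj_conj] at h2
    rw [ContinuousLinearMap.adjoint_inner_right, h2]
  have e3 : (2 * Real.pi : ℂ) *
      ⟪y, (Polynomial.aeval M p + (S.opConjCauchy p M).adjoint) x⟫_ℂ =
      ∫ t in (0 : ℝ)..(2 * Real.pi), p.eval (S.curve t) * (⟪y, Q t x⟫_ℂ + ⟪Q t y, x⟫_ℂ) := by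
    rw [add_apply, inner_add_right, mul_add, e1, e2,
      ← intervalIntegral.integral_add]
    · simp only [mul_add]
    all_goals exact Continuous.intervalIntegrable (by fun_prop) _ _
  have e4 : ∫ t in (0 : ℝ)..(2 * Real.pi), B * ((⟪x, Q t x⟫_ℂ).re + (⟪y, Q t y⟫_ℂ).re) =
      2 * Real.pi * (B * (‖x‖ ^ 2 + ‖y‖ ^ 2)) := by
    rw [intervalIntegral.integral_const_mul, intervalIntegral.integral_add, hre_int, hre_int]
    · ring
    all_goals exact (continuous_re.comp (by fun_prop)).intervalIntegrable _ _
  have e5 : ‖(2 * Real.pi : ℂ) *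
      ⟪y, (Polynomial.aeval M p + (S.opConjCauchy p M).adjoint) x⟫_ℂ‖ ≤
      2 * Real.pi * (B * (‖x‖ ^ 2 + ‖y‖ ^ 2)) := by
    rw [e3, ← e4]
    refine intervalIntegral.norm_integral_le_of_norm_le (by positivity)
      (Eventually.of_forall fun t _ => ?_)
      (((continuous_re.comp (by fun_prop)).add
        (continuous_re.comp (by fun_prop))).const_mul B |>.intervalIntegrable _ _)
    rw [norm_mul]
    exact mul_le_mul (hB _ (S.curve_mem_region t)) (norm_inner_add_inner_le (hQ0 t) x y)
      (norm_nonneg _) hB0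
  have e6 : ‖(2 * Real.pi : ℂ)‖ = 2 * Real.pi := by
    rw [norm_mul, norm_real, Real.norm_eq_abs, abs_of_pos hπ]; simp
  rw [norm_mul, e6] at e5
  exact le_of_mul_le_mul_left e5 Real.two_pi_pos

theorem OpGap.exists_norm_aeval_le {M : H →L[ℂ] H} {m : ℝ} (hm : 0 < m) (hM : S.OpGap M m)
    {z : ℂ} (hz : ∀ t, dirRe t z + m ≤ S.h t) :
    ∃ K, ∀ p : Polynomial ℂ, ∀ B, (∀ z ∈ S.region, ‖p.eval z‖ ≤ B) →
      ‖Polynomial.aeval M p‖ ≤ K * B := by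
  have hπ := Real.two_pi_pos
  have hc : Continuous fun t => S.velocity t • resolvent M (S.curve t) := by
    have := hM.continuous_resolvent hm
    have := S.continuous_velocity
    fun_prop
  obtain ⟨C, hC⟩ := (isCompact_Icc (a := (0 : ℝ)) (b := 2 * Real.pi)).exists_bound_of_continuousOn
    hc.continuousOn
  refine ⟨C, fun p B hB => ?_⟩
  have hB0 : 0 ≤ B := (norm_nonneg _).trans (hB _ (S.curve_mem_region 0))
  have h1 := integral_smul_resolvent_polynomial S.hasDerivAt_curve S.continuous_velocity
    (by simpa using S.curve_periodic 0) (hM.mem_resolventSet hm) (hM.integral_resolvent hm hz) p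
  have h2 : ‖(2 * Real.pi * I : ℂ) • Polynomial.aeval M p‖ ≤ (C * B) * |2 * Real.pi - 0| := by
    rw [← h1]
    refine intervalIntegral.norm_integral_le_of_norm_le_const fun t ht => ?_
    rw [uIoc_of_le hπ.le] at ht
    rw [mul_smul, norm_smul, mul_comm]
    exact mul_le_mul (hC t ⟨ht.1.le, ht.2⟩) (hB _ (S.curve_mem_region t)) (norm_nonneg _)
      ((norm_nonneg _).trans (hC t ⟨ht.1.le, ht.2⟩))
  rw [norm_smul, sub_zero, abs_of_pos hπ] at h2
  have e6 : ‖(2 * Real.pi * I : ℂ)‖ = 2 * Real.pi := by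
    rw [norm_mul, norm_mul, norm_real, Real.norm_eq_abs, abs_of_pos Real.pi_pos]; simp
  rw [e6, mul_comm] at h2
  exact le_of_mul_le_mul_right h2 hπ

end SmoothSupport

section ClosedSubalgebra

variable {A : Type*} [NormedRing A] [NormedAlgebra ℂ A] [CompleteSpace A]

theorem Subalgebra.exists_inverse_mem {𝒜 : Subalgebra ℂ A} (h𝒜 : IsClosed (𝒜 : Set A)) {T : A}
    (hT : T ∈ 𝒜) {R : ℝ} (h : ‖(R : ℂ) • (1 : A) - T‖ < R) :
    ∃ V ∈ 𝒜, T * V = 1 ∧ V * T = 1 := by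
  have : CompleteSpace 𝒜 := h𝒜.completeSpace_coe
  obtain ⟨u, hu⟩ := isUnit_of_norm_smul_one_sub_lt (A := 𝒜) (T := ⟨T, hT⟩) (R := R) h
  refine ⟨((u⁻¹ : 𝒜ˣ) : 𝒜), SetLike.coe_mem _, ?_, ?_⟩
  · have := congrArg (Subtype.val) u.mul_inv
    rwa [hu] at this
  · have := congrArg (Subtype.val) u.inv_mul
    rwa [hu] at this

theorem Subalgebra.intervalIntegral_mem {𝒜 : Subalgebra ℂ A} (h𝒜 : IsClosed (𝒜 : Set A))
    {F : ℝ → A} (hF : Continuous F) (hmem : ∀ t, F t ∈ 𝒜) (a b : ℝ) :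
    ∫ t in a..b, F t ∈ 𝒜 := by
  have : CompleteSpace (Subalgebra.toSubmodule 𝒜) := h𝒜.completeSpace_coe
  have h1 := (Subalgebra.toSubmodule 𝒜).subtypeL.intervalIntegral_comp_comm (μ := volume)
    (a := a) (b := b) (f := fun t => ⟨F t, hmem t⟩)
    ((hF.subtype_mk hmem).intervalIntegrable _ _)
  have h2 : ∫ t in a..b, F t = (Subalgebra.toSubmodule 𝒜).subtypeL
      (∫ t in a..b, (⟨F t, hmem t⟩ : Subalgebra.toSubmodule 𝒜)) := h1
  rw [h2]
  exact SetLike.coe_mem (p := Subalgebra.toSubmodule 𝒜) _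

end ClosedSubalgebra

theorem AlgHom.map_resolvent {A B : Type*} [Ring A] [Ring B] [Algebra ℂ A] [Algebra ℂ B]
    (φ : A →ₐ[ℂ] B) {a : A} {z : ℂ} (hz : z ∈ resolventSet ℂ a) :
    φ (resolvent a z) = resolvent (φ a) z := by
  obtain ⟨u, hu⟩ := spectrum.mem_resolventSet_iff.mp hz
  have h1 : algebraMap ℂ B z - φ a = ↑(Units.map φ.toMonoidHom u) := by
    change _ = φ (u : A)
    rw [hu, map_sub, AlgHom.commutes]
  rw [resolvent, resolvent, ← hu, h1, Ring.inverse_unit, Ring.inverse_unit, ← map_inv]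
  rfl

namespace SmoothSupport

variable {S : SmoothSupport}

instance : CompactSpace S.region := isCompact_iff_compactSpace.1 S.isCompact_region

/-- The maximum principle for polynomials on a convex body. -/
theorem norm_eval_le_of_forall_support {p : Polynomial ℂ} {C : ℝ}
    (h : ∀ z ∈ S.region, ∀ s, dirRe s z = S.h s → ‖p.eval z‖ ≤ C) {z : ℂ} (hz : z ∈ S.region) :
    ‖p.eval z‖ ≤ C := by
  have hfr : ∀ w ∈ S.region, w ∉ interior S.region → ‖p.eval w‖ ≤ C := by
    intro w hw hw'
    by_cases hlt : ∀ t, dirRe t w < S.h t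
    · obtain ⟨m, hm, hgap⟩ := exists_gap hlt
      refine absurd (mem_interior_iff_mem_nhds.2 (Metric.mem_nhds_iff.2 ⟨m, hm, fun v hv t => ?_⟩))
        hw'
      have h1 := dirRe_le_norm t (v - w)
      rw [dirRe_sub] at h1
      rw [mem_ball_iff_norm] at hv
      linarith [hgap t]
    · push Not at hlt
      obtain ⟨t, ht⟩ := hlt
      exact h w hw t (le_antisymm (hw t) ht)
  by_cases hzi : z ∈ interior S.region
  · refine Complex.norm_le_of_forall_mem_frontier_norm_le (S.isBounded_region.subset interior_subset)
      p.differentiable.diffContOnCl (fun w hw => ?_) (subset_closure hzi)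
    have := frontier_interior_subset hw
    rw [S.isClosed_region.frontier_eq] at this
    exact hfr w this.1 this.2
  · exact hfr z hz hzi

variable {H : Type*} [NormedAddCommGroup H] [InnerProductSpace ℂ H]

variable (S) in
/-- The identity function on the convex body, paired with an operator. -/
noncomputable def idPair (M : H →L[ℂ] H) : C(S.region, ℂ) × (H →L[ℂ] H) :=
  (⟨Subtype.val, continuous_subtype_val⟩, M)

variable (S) in
/-- The closure of the pairs `(p, p(M))`, for `p` a polynomial. -/
noncomputable def pairAlgebra (M : H →L[ℂ] H) : Subalgebra ℂ (C(S.region, ℂ) × (H →L[ℂ] H)) :=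
  (Polynomial.aeval (S.idPair M)).range.topologicalClosure

/-- Evaluation of the first component at a point. -/
noncomputable def fstEval (z : S.region) : C(S.region, ℂ) × (H →L[ℂ] H) →ₐ[ℂ] ℂ :=
  (ContinuousMap.evalAlgHom ℂ ℂ z).comp (AlgHom.fst ℂ _ _)

theorem fst_aeval_apply (a : C(S.region, ℂ) × (H →L[ℂ] H)) (p : Polynomial ℂ) (z : S.region) :
    (Polynomial.aeval a p).1 z = p.eval (a.1 z) := by
  have := Polynomial.aeval_algHom_apply (fstEval z) a p
  rw [Polynomial.coe_aeval_eq_eval] at this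
  exact this.symm

theorem snd_aeval (a : C(S.region, ℂ) × (H →L[ℂ] H)) (p : Polynomial ℂ) :
    (Polynomial.aeval a p).2 = Polynomial.aeval a.2 p :=
  (Polynomial.aeval_algHom_apply (AlgHom.snd ℂ C(S.region, ℂ) (H →L[ℂ] H)) a p).symm

theorem idPair_mem (M : H →L[ℂ] H) : S.idPair M ∈ S.pairAlgebra M :=
  Subalgebra.le_topologicalClosure _ ⟨Polynomial.X, by simp⟩

theorem isClosed_pairAlgebra (M : H →L[ℂ] H) : 
    IsClosed (S.pairAlgebra M : Set (C(S.region, ℂ) × (H →L[ℂ] H))) :=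
  Subalgebra.isClosed_topologicalClosure _

theorem exists_polynomial_near {M : H →L[ℂ] H} {a : C(S.region, ℂ) × (H →L[ℂ] H)}
    (ha : a ∈ S.pairAlgebra M) {ε : ℝ} (hε : 0 < ε) :
    ∃ p : Polynomial ℂ, (∀ z : S.region, ‖a.1 z - p.eval (z : ℂ)‖ ≤ ε) ∧
      ‖a.2 - Polynomial.aeval M p‖ ≤ ε := by
  obtain ⟨b, ⟨p, rfl⟩, hb⟩ := Metric.mem_closure_iff.1 (show a ∈ closure _ from ha) ε hε
  have hb' : ‖a - Polynomial.aeval (S.idPair M) p‖ ≤ ε := by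
    rw [← dist_eq_norm]; exact hb.le
  refine ⟨p, fun z => ?_, ?_⟩
  · have h1 := ((a - Polynomial.aeval (S.idPair M) p).1.norm_coe_le_norm z).trans
      ((norm_fst_le _).trans hb')
    rw [Prod.fst_sub, ContinuousMap.sub_apply, fst_aeval_apply] at h1
    exact h1
  · have h1 := (norm_snd_le _).trans hb'
    rw [Prod.snd_sub, snd_aeval] at h1
    exact h1

theorem norm_fst_le_of_mem_pairAlgebra {M : H →L[ℂ] H} {a : C(S.region, ℂ) × (H →L[ℂ] H)}
    (ha : a ∈ S.pairAlgebra M) {C : ℝ}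
    (h : ∀ z : S.region, ∀ s, dirRe s z = S.h s → ‖a.1 z‖ ≤ C) (z : S.region) :
    ‖a.1 z‖ ≤ C := by
  refine le_of_forall_pos_le_add fun ε hε => ?_
  obtain ⟨p, hp, -⟩ := exists_polynomial_near ha (half_pos hε)
  have h1 : ‖p.eval (z : ℂ)‖ ≤ C + ε / 2 := by
    refine norm_eval_le_of_forall_support (S := S) (fun w hw s hs => ?_) z.2
    have h2 := norm_sub_norm_le (p.eval w) (a.1 ⟨w, hw⟩)
    rw [norm_sub_rev] at h2
    linarith [hp ⟨w, hw⟩, h ⟨w, hw⟩ s hs]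
  have h2 := norm_sub_norm_le (a.1 z) (p.eval (z : ℂ))
  linarith [hp z]

theorem norm_snd_le_of_mem_pairAlgebra {M : H →L[ℂ] H} {K : ℝ} (hK0 : 0 ≤ K)
    (hK : ∀ p : Polynomial ℂ, ∀ B, (∀ z ∈ S.region, ‖p.eval z‖ ≤ B) →
      ‖Polynomial.aeval M p‖ ≤ K * B)
    {a : C(S.region, ℂ) × (H →L[ℂ] H)} (ha : a ∈ S.pairAlgebra M) {B : ℝ}
    (hB : ∀ z : S.region, ‖a.1 z‖ ≤ B) : ‖a.2‖ ≤ K * B := by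
  refine le_of_forall_pos_le_add fun ε hε => ?_
  have hδ : 0 < ε / (K + 1) := by positivity
  obtain ⟨p, hp, hp'⟩ := exists_polynomial_near ha hδ
  have h1 := hK p (B + ε / (K + 1)) fun z hz => by
    have h2 := norm_sub_norm_le (p.eval z) (a.1 ⟨z, hz⟩)
    rw [norm_sub_rev] at h2
    linarith [hp ⟨z, hz⟩, hB ⟨z, hz⟩]
  have h2 := norm_sub_norm_le a.2 (Polynomial.aeval M p)
  have h3 : K * (ε / (K + 1)) + ε / (K + 1) = ε := by field_simp
  linarith

theorem OpGap.mono {M : H →L[ℂ] H} {m m' : ℝ} (hM : S.OpGap M m) (h : m' ≤ m) :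
    S.OpGap M m' := fun t x => by
  have := mul_le_mul_of_nonneg_right h (sq_nonneg ‖x‖)
  linarith [hM t x]

variable [CompleteSpace H]

theorem exists_resolvent_mem {M : H →L[ℂ] H} {a : C(S.region, ℂ) × (H →L[ℂ] H)}
    (ha : a ∈ S.pairAlgebra M) {m : ℝ} (hm : 0 < m) (h1 : ∀ z t, dirRe t (a.1 z) + m ≤ S.h t)
    (h2 : S.OpGap a.2 m) (t : ℝ) :
    S.curve t ∈ resolventSet ℂ a ∧ resolvent a (S.curve t) ∈ S.pairAlgebra M := by
  set c := exp (-(t * I)) with hc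
  have hc0 : c ≠ 0 := exp_ne_zero _
  set b := algebraMap ℂ (C(S.region, ℂ) × (H →L[ℂ] H)) (S.curve t) - a with hb
  have hbmem : c • b ∈ S.pairAlgebra M :=
    Subalgebra.smul_mem _ (sub_mem (Subalgebra.algebraMap_mem _ _) ha) _
  set R := max m (‖c • b‖ ^ 2 / m) with hR
  have hRm : m ≤ R := le_max_left _ _
  have hRn : ‖c • b‖ ^ 2 ≤ R * m := (div_le_iff₀ hm).1 (le_max_right _ _)
  have hnorm : ‖(R : ℂ) • (1 : C(S.region, ℂ) × (H →L[ℂ] H)) - c • b‖ < R := by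
    have h3 : ‖(R : ℂ) • (1 : C(S.region, ℂ)) - (c • b).1‖ ≤ R - m / 2 := by
      refine (ContinuousMap.norm_le _ (by linarith)).2 fun z => ?_
      have h4 : ((R : ℂ) • (1 : C(S.region, ℂ)) - (c • b).1) z =
          (R : ℂ) - c * (S.curve t - a.1 z) := by simp [hb, Algebra.algebraMap_eq_smul_one]
      rw [h4]
      refine norm_sub_le_of_le_re hm hRm ?_ (le_trans ?_ hRn)
      · change m ≤ dirRe t _
        rw [dirRe_sub, dirRe_curve_self]
        linarith [h1 z t]
      · have h5 : c * (S.curve t - a.1 z) = (c • b).1 z := by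
          simp [hb, Algebra.algebraMap_eq_smul_one]
        rw [h5]
        gcongr
        exact ((c • b).1.norm_coe_le_norm z).trans (norm_fst_le _)
    have h4 : ‖(R : ℂ) • (1 : H →L[ℂ] H) - (c • b).2‖ ≤ R - m / 2 := by
      refine norm_smul_one_sub_le hm hRm (h2.le_re_inner t) (le_trans ?_ hRn)
      gcongr
      exact norm_snd_le (c • b)
    refine (norm_prod_le_iff.2 ⟨h3, h4⟩ : _ ≤ R - m / 2).trans_lt (by linarith)
  obtain ⟨V, hV, hV1, hV2⟩ := Subalgebra.exists_inverse_mem (isClosed_pairAlgebra M) hbmem hnorm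
  set u : (C(S.region, ℂ) × (H →L[ℂ] H))ˣ :=
    ⟨b, c • V, by rwa [smul_mul_assoc, ← mul_smul_comm] at hV1,
      by rwa [mul_smul_comm, ← smul_mul_assoc] at hV2⟩ with hu
  have hub : (u : C(S.region, ℂ) × (H →L[ℂ] H)) = b := rfl
  refine ⟨spectrum.mem_resolventSet_iff.2 ⟨u, hub⟩, ?_⟩
  rw [resolvent, ← hb, ← hub, Ring.inverse_unit]
  exact Subalgebra.smul_mem _ hV c

/-- The Cauchy transform of the conjugate of a polynomial belongs to the closed algebra. -/
theorem exists_conjCauchy_mem {M : H →L[ℂ] H} {a : C(S.region, ℂ) × (H →L[ℂ] H)}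
    (ha : a ∈ S.pairAlgebra M) {m : ℝ} (hm : 0 < m) (h1 : ∀ z t, dirRe t (a.1 z) + m ≤ S.h t)
    (h2 : S.OpGap a.2 m) (p : Polynomial ℂ) :
    ∃ g ∈ S.pairAlgebra M, (∀ z, g.1 z = S.conjCauchy p (a.1 z)) ∧
      g.2 = S.opConjCauchy p a.2 := by
  have hres := exists_resolvent_mem ha hm h1 h2
  have hRc : Continuous fun t => resolvent a (S.curve t) := by
    rw [← continuousOn_univ]
    exact continuousOn_resolvent_comp continuousOn_const S.continuous_curve.continuousOn
      fun t _ => (hres t).1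
  set F : ℝ → C(S.region, ℂ) × (H →L[ℂ] H) := fun t =>
    ((starRingEnd ℂ) (p.eval (S.curve t)) * S.velocity t) • resolvent a (S.curve t) with hF
  have hFc : Continuous F := by
    have := S.continuous_velocity
    have : Continuous fun t => p.eval (S.curve t) := p.continuous.comp S.continuous_curve
    fun_prop
  refine ⟨(2 * Real.pi * I)⁻¹ • ∫ t in (0 : ℝ)..(2 * Real.pi), F t, Subalgebra.smul_mem _
    (Subalgebra.intervalIntegral_mem (isClosed_pairAlgebra M) hFc
      (fun t => Subalgebra.smul_mem _ (hres t).2 _) _ _) _, fun z => ?_, ?_⟩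
  · have h3 := ((ContinuousMap.evalCLM ℂ z).comp
      (ContinuousLinearMap.fst ℂ C(S.region, ℂ) (H →L[ℂ] H))).intervalIntegral_comp_comm
      (hFc.intervalIntegrable (μ := volume) 0 (2 * Real.pi))
    have h4 : ∀ t, (F t).1 z = (starRingEnd ℂ) (p.eval (S.curve t)) *
        (S.velocity t / (S.curve t - a.1 z)) := fun t => by
      have h5 : fstEval z (resolvent a (S.curve t)) = _ := AlgHom.map_resolvent _ (hres t).1
      have h6 : resolvent (fstEval z a) (S.curve t) = (S.curve t - a.1 z)⁻¹ := by
        simp only [resolvent, Algebra.algebraMap_self, RingHom.id_apply, Ring.inverse_eq_inv']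
        rfl
      rw [h6] at h5
      rw [div_eq_mul_inv, ← mul_assoc, ← h5]
      rfl
    rw [conjCauchy, Prod.smul_fst, ContinuousMap.smul_apply, smul_eq_mul]
    congr 1
    refine h3.symm.trans ?_
    exact intervalIntegral.integral_congr fun t _ => h4 t
  · have h3 := (ContinuousLinearMap.snd ℂ C(S.region, ℂ) (H →L[ℂ] H)).intervalIntegral_comp_comm
      (hFc.intervalIntegrable (μ := volume) 0 (2 * Real.pi))
    rw [opConjCauchy, Prod.smul_snd]
    congr 1
    refine h3.symm.trans ?_
    refine intervalIntegral.integral_congr fun t _ => ?_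
    exact congrArg (((starRingEnd ℂ) (p.eval (S.curve t)) * S.velocity t) • ·)
      (AlgHom.map_resolvent (AlgHom.snd ℂ C(S.region, ℂ) (H →L[ℂ] H)) (hres t).1)

end SmoothSupport

theorem norm_pow_four_le_of_norm_add_star_le {A : Type*} [NormedRing A] [StarRing A] [CStarRing A]
    {T G : A} {N K : ℝ} (hN : ‖T + star G‖ ≤ N) (hK : ‖T * G * T‖ ≤ K) :
    ‖T‖ ^ 4 ≤ N * ‖T‖ ^ 3 + K * ‖T‖ := by
  have h1 : ‖T * star T * (T * star T)‖ = ‖T‖ ^ 4 := by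
    have h2 := CStarRing.norm_self_mul_star (x := T * star T)
    rw [star_mul, star_star] at h2
    rw [h2, CStarRing.norm_self_mul_star]
    ring
  have h3 : T * star T * (T * star T) =
      T * star (T + star G) * (T * star T) - T * G * T * star T := by
    rw [star_add, star_star]; noncomm_ring
  rw [← h1, h3]
  refine (norm_sub_le _ _).trans (add_le_add ?_ ?_)
  · calc ‖T * star (T + star G) * (T * star T)‖
        ≤ ‖T‖ * ‖star (T + star G)‖ * (‖T‖ * ‖star T‖) :=
          (norm_mul_le _ _).trans (mul_le_mul (norm_mul_le _ _) (norm_mul_le _ _)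
            (norm_nonneg _) (by positivity))
      _ = ‖T + star G‖ * ‖T‖ ^ 3 := by rw [norm_star, norm_star]; ring
      _ ≤ N * ‖T‖ ^ 3 := by gcongr
  · refine (norm_mul_le _ _).trans ?_
    rw [norm_star]
    gcongr

namespace SmoothSupport

variable {S : SmoothSupport} {H : Type*} [NormedAddCommGroup H] [InnerProductSpace ℂ H]
  [CompleteSpace H]

theorem OpGap.eventually_pow_four_le {M : H →L[ℂ] H} {m : ℝ} (hm : 0 < m) (hM : S.OpGap M m)
    {z₀ : ℂ} (hz₀ : ∀ t, dirRe t z₀ + m ≤ S.h t) {K : ℝ} (hK0 : 0 ≤ K)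
    (hK : ∀ p : Polynomial ℂ, ∀ B, (∀ z ∈ S.region, ‖p.eval z‖ ≤ B) →
      ‖Polynomial.aeval M p‖ ≤ K * B)
    {p : Polynomial ℂ} (hp : ∀ z ∈ S.region, ‖p.eval z‖ ≤ 1) {ε : ℝ} (hε : 0 < ε) :
    ∀ᶠ r : ℝ in 𝓝[<] 1,
      ‖Polynomial.aeval (algebraMap ℂ (H →L[ℂ] H) z₀ + (r : ℂ) • (M - algebraMap ℂ _ z₀)) p‖ ^ 4 ≤
      2 * ‖Polynomial.aeval
        (algebraMap ℂ (H →L[ℂ] H) z₀ + (r : ℂ) • (M - algebraMap ℂ _ z₀)) p‖ ^ 3 +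
      K * (1 + ε) * ‖Polynomial.aeval
        (algebraMap ℂ (H →L[ℂ] H) z₀ + (r : ℂ) • (M - algebraMap ℂ _ z₀)) p‖ := by
  obtain ⟨d, hd, hg⟩ := norm_conjCauchy_le hε hp
  obtain ⟨C, hC⟩ := (isCompact_Icc (a := (0 : ℝ)) (b := 2 * Real.pi)).exists_bound_of_continuousOn
    S.continuous_h.continuousOn
  have hsup : ∀ s, S.h s - dirRe s z₀ ≤ C + ‖z₀‖ := fun s => by
    obtain ⟨y, hy, hys⟩ := S.periodic_h.exists_mem_Ico₀ Real.two_pi_pos s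
    have h1 := (le_abs_self _).trans (hC y ⟨hy.1, hy.2.le⟩)
    have h2 := dirRe_le_norm s (-z₀)
    have h3 : dirRe s (-z₀) = -dirRe s z₀ := by simp [dirRe]
    rw [norm_neg, h3] at h2
    rw [hys]
    linarith
  have hC0 : 0 < C + ‖z₀‖ := by linarith [hsup 0, hz₀ 0]
  have hr0 : max 0 (1 - d / (C + ‖z₀‖)) < 1 := max_lt one_pos (by linarith [div_pos hd hC0])
  filter_upwards [Ioo_mem_nhdsLT hr0] with r hr
  have hr1 : 0 < r := (le_max_left _ _).trans_lt hr.1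
  have hrd : (1 - r) * (C + ‖z₀‖) ≤ d := by
    rw [← le_div_iff₀ hC0]; linarith [(le_max_right _ _).trans_lt hr.1]
  set a : C(S.region, ℂ) × (H →L[ℂ] H) :=
    algebraMap ℂ _ z₀ + (r : ℂ) • (S.idPair M - algebraMap ℂ _ z₀) with ha
  have hamem : a ∈ S.pairAlgebra M := add_mem (Subalgebra.algebraMap_mem _ _)
    (Subalgebra.smul_mem _ (sub_mem (idPair_mem M) (Subalgebra.algebraMap_mem _ _)) _)
  have ha1 : ∀ z, a.1 z = ((1 - r : ℝ) : ℂ) * z₀ + (r : ℂ) * z := fun z => by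
    have : a.1 z = z₀ + r * (z - z₀) := by simp [ha, idPair, Algebra.algebraMap_eq_smul_one]
    rw [this]; push_cast; ring
  have ha2 : a.2 = algebraMap ℂ (H →L[ℂ] H) z₀ + (r : ℂ) • (M - algebraMap ℂ _ z₀) := rfl
  rw [← ha2]
  have hdir : ∀ z t, dirRe t (a.1 z) = (1 - r) * dirRe t z₀ + r * dirRe t z := fun z t => by
    rw [ha1, dirRe_add, dirRe_real_mul, dirRe_real_mul]
  have hm' : 0 < (1 - r) * m := mul_pos (by linarith [hr.2]) hm
  have hgap1 : ∀ z t, dirRe t (a.1 z) + (1 - r) * m ≤ S.h t := fun z t => by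
    rw [hdir]
    have h1 := mul_le_mul_of_nonneg_left (hz₀ t) (sub_nonneg.2 hr.2.le)
    have h2 := mul_le_mul_of_nonneg_left (z.2 t) hr1.le
    linarith
  have hgap2 : S.OpGap a.2 m := hM.homotopy hz₀ ⟨hr1.le, hr.2.le⟩
  obtain ⟨g, hgmem, hg1, hg2⟩ := exists_conjCauchy_mem hamem hm' hgap1
    (hgap2.mono (by nlinarith)) p
  have hgn : ∀ z, ‖g.1 z‖ ≤ 1 + ε := norm_fst_le_of_mem_pairAlgebra hgmem fun z s hs => by
    rw [hg1]
    refine hg _ (fun t => by linarith [hgap1 z t]) s ?_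
    rw [hdir, hs]
    have := mul_le_mul_of_nonneg_left (hsup s) (sub_nonneg.2 hr.2.le)
    linarith
  have hpmem : Polynomial.aeval a p ∈ S.pairAlgebra M :=
    Algebra.adjoin_le (singleton_subset_iff.2 hamem) (Polynomial.aeval_mem_adjoin_singleton ℂ a)
  have hpn : ∀ z, ‖(Polynomial.aeval a p).1 z‖ ≤ 1 := fun z => by
    rw [fst_aeval_apply]
    exact hp _ fun t => by linarith [hgap1 z t]
  have hprod := norm_snd_le_of_mem_pairAlgebra hK0 hK
    (mul_mem (mul_mem hpmem hgmem) hpmem) (B := 1 + ε) fun z => by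
      rw [Prod.fst_mul, Prod.fst_mul, ContinuousMap.mul_apply, ContinuousMap.mul_apply, norm_mul,
        norm_mul]
      have h1 := hpn z
      have h2 := hgn z
      have h3 : ‖(Polynomial.aeval a p).1 z‖ * ‖g.1 z‖ ≤ 1 * (1 + ε) := by gcongr
      calc _ ≤ 1 * (1 + ε) * 1 := by gcongr
        _ = _ := by ring
  rw [Prod.snd_mul, Prod.snd_mul, snd_aeval, hg2] at hprod
  refine norm_pow_four_le_of_norm_add_star_le ?_ hprod
  have := hgap2.norm_aeval_add_adjoint_le hm hz₀ hp
  rwa [mul_one] at this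

theorem OpGap.pow_four_le {M : H →L[ℂ] H} {m : ℝ} (hm : 0 < m) (hM : S.OpGap M m)
    {z₀ : ℂ} (hz₀ : ∀ t, dirRe t z₀ + m ≤ S.h t) {K : ℝ} (hK0 : 0 ≤ K)
    (hK : ∀ p : Polynomial ℂ, ∀ B, (∀ z ∈ S.region, ‖p.eval z‖ ≤ B) →
      ‖Polynomial.aeval M p‖ ≤ K * B)
    {p : Polynomial ℂ} (hp : ∀ z ∈ S.region, ‖p.eval z‖ ≤ 1) :
    ‖Polynomial.aeval M p‖ ^ 4 ≤
      2 * ‖Polynomial.aeval M p‖ ^ 3 + K * ‖Polynomial.aeval M p‖ := by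
  have hlim : Tendsto (fun r : ℝ => ‖Polynomial.aeval
      (algebraMap ℂ (H →L[ℂ] H) z₀ + (r : ℂ) • (M - algebraMap ℂ _ z₀)) p‖) (𝓝[<] 1)
      (𝓝 ‖Polynomial.aeval M p‖) := by
    have hc : Continuous (fun r : ℝ => ‖Polynomial.aeval
        (algebraMap ℂ (H →L[ℂ] H) z₀ + (r : ℂ) • (M - algebraMap ℂ _ z₀)) p‖) :=
      (p.continuous_aeval.comp (by fun_prop)).norm
    have h1 := hc.tendsto 1
    rw [ofReal_one, one_smul, add_sub_cancel] at h1
    exact h1.mono_left nhdsWithin_le_nhds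
  have key : ∀ ε > 0, ‖Polynomial.aeval M p‖ ^ 4 ≤
      2 * ‖Polynomial.aeval M p‖ ^ 3 + K * (1 + ε) * ‖Polynomial.aeval M p‖ := fun ε hε =>
    le_of_tendsto_of_tendsto (hlim.pow 4) (((hlim.pow 3).const_mul 2).add (hlim.const_mul _))
      (hM.eventually_pow_four_le hm hz₀ hK0 hK hp hε)
  have hlim2 : Tendsto (fun ε : ℝ => 2 * ‖Polynomial.aeval M p‖ ^ 3 +
      K * (1 + ε) * ‖Polynomial.aeval M p‖) (𝓝[>] 0)
      (𝓝 (2 * ‖Polynomial.aeval M p‖ ^ 3 + K * ‖Polynomial.aeval M p‖)) := by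
    have hc : Continuous (fun ε : ℝ => 2 * ‖Polynomial.aeval M p‖ ^ 3 +
      K * (1 + ε) * ‖Polynomial.aeval M p‖) := by fun_prop
    have h1 := hc.tendsto 0
    rw [add_zero, mul_one] at h1
    exact h1.mono_left nhdsWithin_le_nhds
  refine ge_of_tendsto hlim2 ?_
  filter_upwards [self_mem_nhdsWithin] with ε hε using key ε hε

/-- The Crouzeix–Palencia bound for a convex body with smooth support function. -/
theorem OpGap.norm_aeval_le {M : H →L[ℂ] H} {m : ℝ} (hm : 0 < m) (hM : S.OpGap M m)
    {z₀ : ℂ} (hz₀ : ∀ t, dirRe t z₀ + m ≤ S.h t) (p : Polynomial ℂ) {B : ℝ}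
    (hp : ∀ z ∈ S.region, ‖p.eval z‖ ≤ B) :
    ‖Polynomial.aeval M p‖ ≤ (1 + Real.sqrt 2) * B := by
  obtain ⟨C, hC⟩ := hM.exists_norm_aeval_le hm hz₀
  set s : Set ℝ := {x | ∃ q : Polynomial ℂ, (∀ z ∈ S.region, ‖q.eval z‖ ≤ 1) ∧
    ‖Polynomial.aeval M q‖ = x} with hs
  have hbdd : BddAbove s := ⟨C, by
    rintro x ⟨q, hq, rfl⟩
    simpa using hC q 1 hq⟩
  have hne : s.Nonempty := ⟨_, 0, by simp, rfl⟩
  set K := sSup s with hKdef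
  have hK0 : 0 ≤ K := le_csSup hbdd ⟨0, by simp, by simp⟩
  have hK : ∀ q : Polynomial ℂ, ∀ B, (∀ z ∈ S.region, ‖q.eval z‖ ≤ B) →
      ‖Polynomial.aeval M q‖ ≤ K * B := by
    intro q B hq
    have hB0 : 0 ≤ B := (norm_nonneg _).trans (hq _ (S.curve_mem_region 0))
    rcases hB0.eq_or_lt with rfl | hB
    · simpa using hC q 0 hq
    · have h1 : ‖Polynomial.aeval M (((B⁻¹ : ℝ) : ℂ) • q)‖ ≤ K :=
        le_csSup hbdd ⟨_, fun z hz => by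
          rw [Polynomial.eval_smul, norm_smul, norm_real, Real.norm_eq_abs,
            abs_of_pos (inv_pos.2 hB), inv_mul_le_iff₀ hB, mul_one]
          exact hq z hz, rfl⟩
      rw [map_smul, norm_smul, norm_real, Real.norm_eq_abs, abs_of_pos (inv_pos.2 hB),
        inv_mul_le_iff₀ hB, mul_comm] at h1
      exact h1
  have hcube : K ^ 3 ≤ 2 * K ^ 2 + K := by
    have hx : ∀ x ∈ s, x ^ 4 - 2 * x ^ 3 ≤ K * x := by
      rintro x ⟨q, hq, rfl⟩
      linarith [hM.pow_four_le hm hz₀ hK0 hK hq]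
    have hcl : K ∈ closure s := csSup_mem_closure hne hbdd
    have h4 : K ^ 4 - 2 * K ^ 3 ≤ K * K := by
      have hcs : IsClosed {x : ℝ | x ^ 4 - 2 * x ^ 3 ≤ K * x} :=
        isClosed_le (by fun_prop) (by fun_prop)
      exact hcs.closure_subset_iff.2 hx hcl
    rcases hK0.eq_or_lt with h0 | h0
    · rw [← h0]; norm_num
    · refine le_of_mul_le_mul_left ?_ h0
      linarith
  have h2 : Real.sqrt 2 ^ 2 = 2 := Real.sq_sqrt (by norm_num)
  have hle : K ≤ 1 + Real.sqrt 2 := by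
    rcases hK0.eq_or_lt with h0 | h0
    · rw [← h0]; positivity
    · have h3 : K ^ 2 ≤ 2 * K + 1 := by
        refine le_of_mul_le_mul_left ?_ h0
        linarith
      nlinarith [Real.sqrt_nonneg 2]
  have hB0 : 0 ≤ B := (norm_nonneg _).trans (hp _ (S.curve_mem_region 0))
  exact (hK p B hp).trans (mul_le_mul_of_nonneg_right hle hB0)

end SmoothSupport

section Averaging

variable {f : ℝ → ℝ}

/-- Averaging a continuous function twice over an interval gives a second difference of its second
antiderivative. -/
theorem integral_integral_eq_second_difference (hf : Continuous f) (ε t : ℝ) :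
    ∫ u in (0 : ℝ)..ε, ∫ v in (0 : ℝ)..ε, f (t + u - v) =
      (∫ x in (0 : ℝ)..(t + ε), ∫ y in (0 : ℝ)..x, f y) -
        2 * (∫ x in (0 : ℝ)..t, ∫ y in (0 : ℝ)..x, f y) +
        ∫ x in (0 : ℝ)..(t - ε), ∫ y in (0 : ℝ)..x, f y := by
  set F : ℝ → ℝ := fun x => ∫ y in (0 : ℝ)..x, f y with hF
  have hFd : ∀ x, HasDerivAt F (f x) x := fun x => (hf.integral_hasStrictDerivAt 0 x).hasDerivAt
  have hFc : Continuous F := continuous_iff_continuousAt.2 fun x => (hFd x).continuousAt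
  have hinner : ∀ u, ∫ v in (0 : ℝ)..ε, f (t + u - v) = F (t + u) - F (t + u - ε) := fun u => by
    rw [intervalIntegral.integral_comp_sub_left, sub_zero,
      ← intervalIntegral.integral_interval_sub_left (hf.intervalIntegrable 0 _)
        (hf.intervalIntegrable 0 _)]
  simp_rw [hinner]
  set G : ℝ → ℝ := fun x => ∫ y in (0 : ℝ)..x, F y with hG
  have hGd : ∀ x, HasDerivAt G (F x) x := fun x => (hFc.integral_hasStrictDerivAt 0 x).hasDerivAt
  have hd : ∀ u, HasDerivAt (fun u => G (t + u) - G (t + u - ε)) (F (t + u) - F (t + u - ε)) u :=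
    fun u => ((hGd _).comp_const_add t u).sub
      (((hGd (t + u - ε)).comp_sub_const (t + u) ε).comp_const_add t u)
  rw [intervalIntegral.integral_eq_sub_of_hasDerivAt (fun u _ => hd u)
    (Continuous.intervalIntegrable (by fun_prop) _ _)]
  simp only [add_zero, add_sub_cancel_right]
  ring

theorem abs_integral_integral_sub_le (hf : Continuous f) {ε L : ℝ} (hε : 0 ≤ ε) (hL : 0 ≤ L)
    (hLip : ∀ x y, |f x - f y| ≤ L * |x - y|) (t : ℝ) :
    |(∫ u in (0 : ℝ)..ε, ∫ v in (0 : ℝ)..ε, f (t + u - v)) - ε ^ 2 * f t| ≤ L * ε * ε ^ 2 := by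
  have h1 : ∀ u ∈ Icc (0 : ℝ) ε, |(∫ v in (0 : ℝ)..ε, f (t + u - v)) - ε * f t| ≤ L * ε * ε := by
    intro u hu
    have h2 : (∫ v in (0 : ℝ)..ε, f (t + u - v)) - ε * f t =
        ∫ v in (0 : ℝ)..ε, (f (t + u - v) - f t) := by
      rw [intervalIntegral.integral_sub]
      · simp
      all_goals exact Continuous.intervalIntegrable (by fun_prop) _ _
    rw [h2]
    have h3 := intervalIntegral.norm_integral_le_of_norm_le_const (a := 0) (b := ε) (C := L * ε)
      (f := fun v => f (t + u - v) - f t) fun v hv => by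
        rw [uIoc_of_le hε] at hv
        refine (hLip _ _).trans (mul_le_mul_of_nonneg_left ?_ hL)
        rw [abs_le]
        constructor <;> linarith [hu.1, hu.2, hv.1, hv.2]
    rwa [sub_zero, abs_of_nonneg hε] at h3
  have hc : Continuous fun u => ∫ v in (0 : ℝ)..ε, f (t + u - v) :=
    intervalIntegral.continuous_parametric_intervalIntegral_of_continuous'
      (by simp only [Function.uncurry_def]; fun_prop) _ _
  have h2 : (∫ u in (0 : ℝ)..ε, ∫ v in (0 : ℝ)..ε, f (t + u - v)) - ε ^ 2 * f t =
      ∫ u in (0 : ℝ)..ε, ((∫ v in (0 : ℝ)..ε, f (t + u - v)) - ε * f t) := by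
    rw [intervalIntegral.integral_sub]
    · simp; ring
    all_goals exact Continuous.intervalIntegrable (by fun_prop) _ _
  rw [h2]
  have h3 := intervalIntegral.norm_integral_le_of_norm_le_const (a := 0) (b := ε) (C := L * ε * ε)
    (f := fun u => (∫ v in (0 : ℝ)..ε, f (t + u - v)) - ε * f t) fun v hv => by
      rw [uIoc_of_le hε] at hv
      exact h1 v ⟨hv.1.le, hv.2⟩
  rw [sub_zero, abs_of_nonneg hε] at h3
  calc _ ≤ _ := h3
    _ = _ := by ring

end Averaging

section SupportFunction

/-- The support function of a set in the direction `exp (t * I)`. -/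
noncomputable def supportFun (K : Set ℂ) (t : ℝ) : ℝ := sSup (dirRe t '' K)

variable {K : Set ℂ} {R : ℝ}

theorem abs_dirRe_sub_le (s t : ℝ) (z : ℂ) : |dirRe s z - dirRe t z| ≤ 2 * ‖z‖ * |s - t| := by
  have h : dirRe s z - dirRe t z =
      (Real.cos s - Real.cos t) * z.re + (Real.sin s - Real.sin t) * z.im := by
    rw [dirRe_eq, dirRe_eq]; ring
  rw [h]
  refine (abs_add_le _ _).trans ?_
  rw [abs_mul, abs_mul]
  have h1 := mul_le_mul (Real.abs_cos_sub_cos_le s t) (abs_re_le_norm z) (abs_nonneg _)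
    (abs_nonneg _)
  have h2 := mul_le_mul (Real.abs_sin_sub_sin_le s t) (abs_im_le_norm z) (abs_nonneg _)
    (abs_nonneg _)
  linarith

theorem dirRe_le_supportFun (hR : ∀ z ∈ K, ‖z‖ ≤ R) {z : ℂ} (hz : z ∈ K) (t : ℝ) :
    dirRe t z ≤ supportFun K t :=
  le_csSup ⟨R, by rintro _ ⟨w, hw, rfl⟩; exact (dirRe_le_norm t w).trans (hR w hw)⟩ ⟨z, hz, rfl⟩

theorem IsCompact.exists_supportFun_eq (hK : IsCompact K) (hne : K.Nonempty) (t : ℝ) :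
    ∃ z ∈ K, supportFun K t = dirRe t z := by
  have hc : Continuous (dirRe t) :=
    continuous_dirRe.comp (f := fun z : ℂ => (t, z)) (by fun_prop)
  obtain ⟨z, hz, h⟩ := (hK.image hc).sSup_mem (hne.image _)
  exact ⟨z, hz, h.symm⟩

theorem periodic_supportFun : Function.Periodic (supportFun K) (2 * Real.pi) := fun t => by
  have : dirRe (t + 2 * Real.pi) = dirRe t := funext fun z => dirRe_periodic z t
  rw [supportFun, this, supportFun]

theorem abs_supportFun_sub_le (hK : IsCompact K) (hne : K.Nonempty) (hR : ∀ z ∈ K, ‖z‖ ≤ R)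
    (s t : ℝ) : |supportFun K s - supportFun K t| ≤ 2 * R * |s - t| := by
  have key : ∀ s t, supportFun K s - supportFun K t ≤ 2 * R * |s - t| := fun s t => by
    obtain ⟨z, hz, h⟩ := hK.exists_supportFun_eq hne s
    have h1 := (le_abs_self _).trans (abs_dirRe_sub_le s t z)
    have h2 := mul_le_mul_of_nonneg_right (hR z hz) (abs_nonneg (s - t))
    linarith [dirRe_le_supportFun hR hz t]
  rw [abs_le]
  have h1 := key t s
  rw [abs_sub_comm] at h1
  exact ⟨by linarith, key s t⟩

theorem abs_supportFun_le (hK : IsCompact K) (hne : K.Nonempty) (hR : ∀ z ∈ K, ‖z‖ ≤ R) (t : ℝ) :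
    |supportFun K t| ≤ R := by
  obtain ⟨z, hz, h⟩ := hK.exists_supportFun_eq hne t
  have h1 := dirRe_le_norm t z
  have h2 := dirRe_le_norm t (-z)
  have h3 : dirRe t (-z) = -dirRe t z := by simp [dirRe]
  rw [norm_neg, h3] at h2
  rw [h, abs_le]
  constructor <;> linarith [hR z hz]

theorem two_mul_cos_mul_supportFun_le (hK : IsCompact K) (hne : K.Nonempty)
    (hR : ∀ z ∈ K, ‖z‖ ≤ R) (s t : ℝ) :
    2 * Real.cos s * supportFun K t ≤ supportFun K (t + s) + supportFun K (t - s) := by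
  obtain ⟨z, hz, h⟩ := hK.exists_supportFun_eq hne t
  have h1 := dirRe_le_supportFun hR hz (t + s)
  have h2 := dirRe_le_supportFun hR hz (t - s)
  have h3 : dirRe (t + s) z + dirRe (t - s) z = 2 * Real.cos s * dirRe t z := by
    simp only [dirRe_eq, Real.cos_add, Real.cos_sub, Real.sin_add, Real.sin_sub]; ring
  rw [h]
  linarith

theorem IsCompact.exists_smoothSupport (hK : IsCompact K) (hne : K.Nonempty) {δ : ℝ} (hδ : 0 < δ) :
    ∃ S : SmoothSupport, (∀ t, supportFun K t + δ / 4 ≤ S.h t) ∧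
      ∀ t, S.h t ≤ supportFun K t + 3 * δ / 4 := by
  obtain ⟨R, hR0, hR⟩ := hK.isBounded.exists_pos_norm_le
  set f := supportFun K with hf
  have hLip := abs_supportFun_sub_le hK hne hR
  have hfc : Continuous f := by
    refine (LipschitzWith.of_dist_le_mul (K := (2 * R).toNNReal) fun x y => ?_).continuous
    rw [Real.coe_toNNReal _ (by positivity), Real.dist_eq, Real.dist_eq]
    exact hLip x y
  set ε : ℝ := min 1 (δ / (8 * R)) with hε
  have hε0 : 0 < ε := by positivity
  have hε1 : ε ≤ 1 := min_le_left _ _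
  have hεR : R * ε ≤ δ / 8 := by
    have := min_le_right 1 (δ / (8 * R))
    rw [← hε, le_div_iff₀ (by positivity)] at this
    linarith
  set F : ℝ → ℝ := fun x => ∫ y in (0 : ℝ)..x, f y with hF
  have hFd : ∀ x, HasDerivAt F (f x) x := fun x => (hfc.integral_hasStrictDerivAt 0 x).hasDerivAt
  have hFc : Continuous F := continuous_iff_continuousAt.2 fun x => (hFd x).continuousAt
  set G : ℝ → ℝ := fun x => ∫ y in (0 : ℝ)..x, F y with hG
  have hGd : ∀ x, HasDerivAt G (F x) x := fun x => (hFc.integral_hasStrictDerivAt 0 x).hasDerivAt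
  have hdiff : ∀ {g g' : ℝ → ℝ}, (∀ x, HasDerivAt g (g' x) x) → ∀ t,
      HasDerivAt (fun t => (g (t + ε) - 2 * g t + g (t - ε)) / ε ^ 2)
        ((g' (t + ε) - 2 * g' t + g' (t - ε)) / ε ^ 2) t := fun hg t =>
    ((((hg _).comp_add_const t ε).sub ((hg t).const_mul 2)).add
      ((hg _).comp_sub_const t ε)).div_const _
  have hrep : ∀ t, G (t + ε) - 2 * G t + G (t - ε) =
      ∫ u in (0 : ℝ)..ε, ∫ v in (0 : ℝ)..ε, f (t + u - v) := fun t =>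
    (integral_integral_eq_second_difference hfc ε t).symm
  have happrox : ∀ t, |(G (t + ε) - 2 * G t + G (t - ε)) / ε ^ 2 - f t| ≤ δ / 4 := fun t => by
    have h1 := abs_integral_integral_sub_le hfc hε0.le (by positivity) hLip t
    rw [← hrep] at h1
    have h2 : (G (t + ε) - 2 * G t + G (t - ε)) / ε ^ 2 - f t =
        ((G (t + ε) - 2 * G t + G (t - ε)) - ε ^ 2 * f t) / ε ^ 2 := by field_simp
    rw [h2, abs_div, abs_of_pos (by positivity : 0 < ε ^ 2), div_le_iff₀ (by positivity)]
    refine h1.trans (mul_le_mul_of_nonneg_right ?_ (by positivity))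
    linarith
  refine ⟨{ h := fun t => (G (t + ε) - 2 * G t + G (t - ε)) / ε ^ 2 + δ / 2
            h' := fun t => (F (t + ε) - 2 * F t + F (t - ε)) / ε ^ 2
            h'' := fun t => (f (t + ε) - 2 * f t + f (t - ε)) / ε ^ 2
            hasDerivAt_h := fun t => (hdiff hGd t).add_const _
            hasDerivAt_h' := hdiff hFd
            continuous_h'' := by fun_prop
            periodic_h := fun t => ?_
            nonneg := fun t => ?_ }, fun t => ?_, fun t => ?_⟩
  · simp only [hrep]
    have h1 : ∀ u v, f (t + 2 * Real.pi + u - v) = f (t + u - v) := fun u v => by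
      rw [hf, ← periodic_supportFun (t + u - v)]
      congr 1; ring
    simp_rw [h1]
  · have h1 := (abs_le.1 (happrox t)).1
    have h2 := two_mul_cos_mul_supportFun_le hK hne hR ε t
    have h4 := Real.one_sub_sq_div_two_le_cos (x := ε)
    have h5 := abs_le.1 (abs_supportFun_le hK hne hR t)
    have hcos : Real.cos ε ≤ 1 - ε ^ 2 / 2 + ε ^ 4 * (5 / 96) := by
      have := (abs_le.1 (Real.cos_bound (x := ε) (by rwa [abs_of_pos hε0]))).2
      rw [abs_of_pos hε0] at this
      linarith
    have h6 : (-(1 : ℝ)) * f t - R * ε ≤ (f (t + ε) - 2 * f t + f (t - ε)) / ε ^ 2 := by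
      rw [le_div_iff₀ (by positivity)]
      have h7 : |(2 * Real.cos ε - 2 + ε ^ 2) * f t| ≤ ε ^ 4 * (5 / 48) * R := by
        rw [abs_mul]
        refine mul_le_mul ?_ (abs_le.2 h5) (abs_nonneg _) (by positivity)
        rw [abs_le]
        constructor
        · have : 0 ≤ ε ^ 4 := by positivity
          linarith
        · linarith
      have h8 := (abs_le.1 h7).1
      have h9 : ε ^ 4 * (5 / 48) * R ≤ R * ε * ε ^ 2 := by
        have : ε ^ 4 ≤ ε ^ 3 := pow_le_pow_of_le_one hε0.le hε1 (by norm_num)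
        have := mul_le_mul_of_nonneg_right this hR0.le
        have h10 : 0 ≤ ε ^ 4 * R := by positivity
        linarith
      linarith
    linarith
  · have h1 := (abs_le.1 (happrox t)).1
    change _ ≤ (G (t + ε) - 2 * G t + G (t - ε)) / ε ^ 2 + δ / 2
    linarith
  · have h1 := (abs_le.1 (happrox t)).2
    change (G (t + ε) - 2 * G t + G (t - ε)) / ε ^ 2 + δ / 2 ≤ _
    linarith

theorem Convex.mem_cthickening_of_dirRe_le (hconv : Convex ℝ K) (hK : IsCompact K)
    (hne : K.Nonempty) {δ : ℝ} (hδ : 0 ≤ δ) {z : ℂ} (hz : ∀ t, dirRe t z ≤ supportFun K t + δ) :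
    z ∈ Metric.cthickening δ K := by
  obtain ⟨w, hw, hmin⟩ := exists_norm_eq_iInf_of_complete_convex hne hK.isComplete hconv z
  rw [norm_eq_iInf_iff_real_inner_le_zero hconv hw] at hmin
  refine Metric.mem_cthickening_of_dist_le z w δ K hw ?_
  rw [dist_eq_norm]
  set t := arg (z - w) with ht
  have hexp : (starRingEnd ℂ) (z - w) = ‖z - w‖ * exp (-(t * I)) := by
    conv_lhs => rw [← norm_mul_exp_arg_mul_I (z - w)]
    rw [map_mul, conj_ofReal, ← exp_conj, map_mul, conj_I, conj_ofReal, mul_neg]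
  have hin : ∀ v, ⟪z - w, v⟫_ℝ = ‖z - w‖ * dirRe t v := fun v => by
    rw [Complex.inner, hexp, dirRe, ← re_ofReal_mul]
    congr 1; ring
  by_cases h0 : ‖z - w‖ = 0
  · rwa [h0]
  have hpos : 0 < ‖z - w‖ := lt_of_le_of_ne (norm_nonneg _) (Ne.symm h0)
  have h1 : dirRe t (z - w) = ‖z - w‖ := by
    have := hin (z - w)
    rw [real_inner_self_eq_norm_sq, sq] at this
    exact (mul_left_cancel₀ h0 this).symm
  obtain ⟨v, hv, hvt⟩ := hK.exists_supportFun_eq hne t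
  have h2 := hmin v hv
  rw [hin, dirRe_sub] at h2
  have h3 : dirRe t v - dirRe t w ≤ 0 := by
    by_contra h
    push Not at h
    linarith [mul_pos hpos h]
  rw [dirRe_sub] at h1
  linarith [hz t]

end SupportFunction

/-- A compact subset of a convex open set is contained in a compact convex subset. -/
theorem IsCompact.exists_compact_convex_between {C Ω : Set ℂ} (hC : IsCompact C)
    (hΩ : IsOpen Ω) (hconv : Convex ℝ Ω) (h : C ⊆ Ω) :
    ∃ K, IsCompact K ∧ Convex ℝ K ∧ C ⊆ K ∧ K ⊆ Ω := by
  classical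
  obtain ⟨u, hu, hCu⟩ : ∃ u : Finset ℂ, (u : Set ℂ) ⊆ Ω ∧ C ⊆ convexHull ℝ (u : Set ℂ) := by
    refine hC.induction_on (p := fun s => ∃ u : Finset ℂ, (u : Set ℂ) ⊆ Ω ∧
      s ⊆ convexHull ℝ (u : Set ℂ)) ⟨∅, by simp⟩ ?_ ?_ fun x hx => ?_
    · rintro s t hst ⟨u, hu, htu⟩
      exact ⟨u, hu, hst.trans htu⟩
    · rintro s t ⟨u, hu, hsu⟩ ⟨v, hv, htv⟩
      refine ⟨u ∪ v, by simp [hu, hv], union_subset (hsu.trans (convexHull_mono ?_))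
        (htv.trans (convexHull_mono ?_))⟩ <;> simp
    · obtain ⟨u, hu1, hu2⟩ := (convex_singleton x).exists_subset_interior_convexHull_finset_of_isCompact
        isCompact_singleton (t := Ω) (by simpa using hΩ.mem_nhds (h hx))
      refine ⟨convexHull ℝ u, mem_nhdsWithin_of_mem_nhds (mem_interior_iff_mem_nhds.1
        (hu1 rfl)), u, (subset_convexHull ℝ _).trans hu2, subset_rfl⟩
  exact ⟨convexHull ℝ u, u.finite_toSet.isCompact_convexHull ℝ, convex_convexHull ℝ _, hCu,
    convexHull_min hu hconv⟩

theorem isBounded_numericalRange {H : Type*} [NormedAddCommGroup H] [InnerProductSpace ℂ H]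
    (M : H →L[ℂ] H) : Bornology.IsBounded {z : ℂ | ∃ x : H, ‖x‖ = 1 ∧ ⟪x, M x⟫_ℂ = z} := by
  rw [isBounded_iff_forall_norm_le]
  refine ⟨‖M‖, ?_⟩
  rintro _ ⟨x, hx, rfl⟩
  have h1 := norm_inner_le_norm (𝕜 := ℂ) x (M x)
  have h2 := M.le_opNorm x
  rw [hx] at h1 h2
  linarith

theorem SmoothSupport.opGap_of_forall_numericalRange {S : SmoothSupport} {H : Type*}
    [NormedAddCommGroup H] [InnerProductSpace ℂ H] {M : H →L[ℂ] H} {m : ℝ}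
    (h : ∀ x : H, ‖x‖ = 1 → ∀ t, dirRe t ⟪x, M x⟫_ℂ + m ≤ S.h t) : S.OpGap M m := by
  intro t x
  rcases eq_or_ne x 0 with rfl | hx
  · simp [dirRe]
  have hx' : (‖x‖ : ℂ) ≠ 0 := by exact_mod_cast norm_ne_zero_iff.2 hx
  have h1 : ⟪x, M x⟫_ℂ = ((‖x‖ ^ 2 : ℝ) : ℂ) * ⟪(‖x‖ : ℂ)⁻¹ • x, M ((‖x‖ : ℂ)⁻¹ • x)⟫_ℂ := by
    rw [map_smul, inner_smul_left, inner_smul_right, map_inv₀, conj_ofReal]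
    push_cast
    field_simp
  rw [h1, dirRe_real_mul, mul_comm m, mul_comm (S.h t), ← mul_add]
  exact mul_le_mul_of_nonneg_left (h _ (norm_smul_inv_norm hx) t) (sq_nonneg _)

/-- **Theorem (Crouzeix–Palencia).** If `Ω ⊆ ℂ` is a bounded convex open set
containing the closure of the numerical range of a bounded operator `M` on a
complex Hilbert space `H`, then `1 + √2` is a spectral constant:
`‖p(M)‖ ≤ (1 + √2) sup_{z ∈ Ω⁻} |p(z)|` for every polynomial `p`. -/
theorem stmt_13 {H : Type*} [NormedAddCommGroup H] [InnerProductSpace ℂ H]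
    [CompleteSpace H] (M : H →L[ℂ] H)
    (Ω : Set ℂ) (hΩconv : Convex ℝ Ω) (hΩopen : IsOpen Ω)
    (hΩbdd : Bornology.IsBounded Ω)
    (hW : closure {z : ℂ | ∃ x : H, ‖x‖ = 1 ∧ ⟪x, M x⟫_ℂ = z} ⊆ Ω) :
    ∀ p : Polynomial ℂ,
      ‖Polynomial.aeval M p‖ ≤
        (1 + Real.sqrt 2) * ⨆ z : closure Ω, ‖p.eval (z : ℂ)‖ := by
  intro p
  rcases subsingleton_or_nontrivial H with hH | hH
  · have : Polynomial.aeval M p = 0 := Subsingleton.elim _ _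
    rw [this, norm_zero]
    exact mul_nonneg (by positivity) (Real.iSup_nonneg fun _ => norm_nonneg _)
  obtain ⟨K, hK, hKconv, hWK, hKΩ⟩ := (isBounded_numericalRange M).isCompact_closure
    |>.exists_compact_convex_between hΩopen hΩconv hW
  have hmem : ∀ x : H, ‖x‖ = 1 → ⟪x, M x⟫_ℂ ∈ K := fun x hx =>
    hWK (subset_closure ⟨x, hx, rfl⟩)
  obtain ⟨x₀, hx₀⟩ := exists_norm_eq H zero_le_one
  have hne : K.Nonempty := ⟨_, hmem x₀ hx₀⟩
  obtain ⟨δ, hδ, hδΩ⟩ := hK.exists_cthickening_subset_open hΩopen hKΩ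
  obtain ⟨S, hS1, hS2⟩ := hK.exists_smoothSupport hne hδ
  obtain ⟨R, hR⟩ := isBounded_iff_forall_norm_le.1 hK.isBounded
  have hgap : ∀ z ∈ K, ∀ t, dirRe t z + δ / 4 ≤ S.h t := fun z hz t => by
    linarith [dirRe_le_supportFun hR hz t, hS1 t]
  have hM : S.OpGap M (δ / 4) :=
    SmoothSupport.opGap_of_forall_numericalRange fun x hx => hgap _ (hmem x hx)
  refine hM.norm_aeval_le (by positivity) (hgap _ (hmem x₀ hx₀)) p fun z hz => ?_
  have hzΩ : z ∈ closure Ω := subset_closure (hδΩ (Metric.cthickening_mono (by linarith) _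
    (hKconv.mem_cthickening_of_dirRe_le hK hne (by positivity : 0 ≤ 3 * δ / 4)
      fun t => (hz t).trans (hS2 t))))
  have hbdd : BddAbove (range fun z : closure Ω => ‖p.eval (z : ℂ)‖) := by
    have := hΩbdd.isCompact_closure.bddAbove_image (f := fun z => ‖p.eval z‖)
      p.continuous.norm.continuousOn
    rwa [image_eq_range] at this
  exact le_ciSup hbdd ⟨z, hzΩ⟩
end

section
/- (Okubo–Ando) Let c ∈ ℂ and r > 0, and let Ω ⊆ ℂ be the open disk of center c and radius r. Let M be a bounded linear operator on a complex Hilbert space H such that the closure of the numerical range W(M) is contained in Ω. Then for every polynomial p ∈ ℂ[X], ‖p(M)‖ ≤ 2 · sup_{|z − c| ≤ r} |p(z)|. -/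
open scoped InnerProductSpace

section CStarAlgebra

variable {A : Type*} [CStarAlgebra A]

theorem norm_aeval_le_of_mem_unitary {U : A} (hU : U ∈ unitary A) (p : Polynomial ℂ) {K : ℝ}
    (hK : ∀ z : ℂ, ‖z‖ ≤ 1 → ‖p.eval z‖ ≤ K) : ‖Polynomial.aeval U p‖ ≤ K := by
  have hK0 : 0 ≤ K := (norm_nonneg _).trans (hK 0 (by simp))
  have hn : IsStarNormal U := ⟨by
    rw [commute_iff_eq, (Unitary.mem_iff.1 hU).1, (Unitary.mem_iff.1 hU).2]⟩
  rw [← cfc_polynomial p U hn]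
  refine norm_cfc_le hK0 fun z hz ↦ hK z ?_
  have := spectrum.subset_circle_of_unitary hU hz
  exact (mem_sphere_zero_iff_norm.1 this).le

theorem aeval_mul_eq_mul_aeval_of_mul_eq {S N C : A} (h : S * N = C * S) (p : Polynomial ℂ) :
    S * Polynomial.aeval N p = Polynomial.aeval C p * S := by
  induction p using Polynomial.induction_on' with
  | add p q hp hq => simp [mul_add, add_mul, hp, hq]
  | monomial n a =>
    have : S * N ^ n = C ^ n * S := (SemiconjBy.pow_right h n : SemiconjBy S (N ^ n) (C ^ n))
    simp only [Polynomial.aeval_monomial, ← Algebra.smul_def, mul_smul_comm, smul_mul_assoc, this]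

theorem moebius_mul_star_self {D E X Y : A} (hX : X * Y = 1)
    (hXX : X + star X - star X * X = D * D) (hXX' : X + star X - X * star X = E * E) :
    X * star Y * D * D * Y * star X = E * E := by
  have h2 : star Y * star X = 1 := by rw [← star_mul, hX, star_one]
  calc X * star Y * D * D * Y * star X = X * star Y * (D * D) * Y * star X := by noncomm_ring
    _ = X * star Y * X * (Y * X) * 0 + (X * star Y * (X * Y) * star X
        + X * (star Y * star X) * Y * star X - X * (star Y * star X) * (X * Y) * star X) := by
      rw [← hXX]; noncomm_ring
    _ = X * (star Y * star X) + X * Y * star X - X * star X := by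
      rw [h2, hX]; simp [mul_assoc, ← mul_assoc X Y, hX, h2]
    _ = E * E := by rw [h2, hX, ← hXX']; simp

variable [PartialOrder A] [StarOrderedRing A]

theorem eq_zero_of_mul_eq_neg_mul {D E Z : A} (hD : 0 ≤ D) (hE : 0 ≤ E) (hDu : IsUnit D)
    (h : E * Z = -(Z * D)) : Z = 0 := by
  have h1 : star Z * E * Z = -(star Z * Z * D) := by rw [mul_assoc, h]; noncomm_ring
  have h2 : 0 ≤ star Z * E * Z := star_left_conjugate_nonneg hE Z
  have hs : IsSelfAdjoint (star Z * Z * D) := by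
    have := (IsSelfAdjoint.of_nonneg h2).neg
    rwa [h1, neg_neg] at this
  have hc : Commute (star Z * Z) D := by
    have := hs.star_eq
    rw [star_mul, (IsSelfAdjoint.of_nonneg hD).star_eq, (IsSelfAdjoint.star_mul_self Z).star_eq]
      at this
    exact this.symm
  have h3 : 0 ≤ star Z * Z * D := hc.mul_nonneg (star_mul_self_nonneg Z) hD
  have h4 : star Z * Z * D = 0 := le_antisymm (by rw [h1] at h2; exact neg_nonneg.1 h2) h3
  have h5 : star Z * Z = 0 := hDu.mul_left_eq_zero.1 h4
  exact CStarRing.star_mul_self_eq_zero_iff Z |>.1 h5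

theorem isStrictlyPositive_one_sub_star_mul_self {C : A} (hC : ‖C‖ < 1) :
    IsStrictlyPositive (1 - star C * C) := by
  have h : ‖star C * C‖ < 1 := by
    rw [CStarRing.norm_star_mul_self]; nlinarith [norm_nonneg C]
  refine IsStrictlyPositive.iff_of_unital.2 ⟨sub_nonneg.2 ?_, isUnit_one_sub_of_norm_lt_one h⟩
  exact (CStarAlgebra.norm_le_one_iff_of_nonneg _ (star_mul_self_nonneg C)).1 h.le

theorem norm_aeval_le_of_norm_lt_one {C : A} (hC : ‖C‖ < 1) (p : Polynomial ℂ) {K : ℝ}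
    (hK : ∀ z : ℂ, ‖z‖ ≤ 1 → ‖p.eval z‖ ≤ K) : ‖Polynomial.aeval C p‖ ≤ K := by
  have hP := isStrictlyPositive_one_sub_star_mul_self hC
  have hQ : IsStrictlyPositive (1 - C * star C) := by
    simpa using isStrictlyPositive_one_sub_star_mul_self (C := star C) (by simpa using hC)
  set D := CFC.sqrt (1 - star C * C)
  set E := CFC.sqrt (1 - C * star C)
  have hD : D * D = 1 - star C * C := CFC.sqrt_mul_sqrt_self _ hP.nonneg
  have hE : E * E = 1 - C * star C := CFC.sqrt_mul_sqrt_self _ hQ.nonneg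
  have hD0 : 0 ≤ D := CFC.sqrt_nonneg _
  have hE0 : 0 ≤ E := CFC.sqrt_nonneg _
  have hDu : IsUnit D := hP.isUnit_cfcSqrt
  have hEu : IsUnit E := hQ.isUnit_cfcSqrt
  have hDs : star D = D := (IsSelfAdjoint.of_nonneg hD0).star_eq
  have hEs : star E = E := (IsSelfAdjoint.of_nonneg hE0).star_eq
  have hEC : E * C = C * D := by
    refine sub_eq_zero.1 (eq_zero_of_mul_eq_neg_mul hD0 hE0 hDu ?_)
    have : E * E * C = C * (D * D) := by rw [hD, hE]; noncomm_ring
    calc E * (E * C - C * D) = E * E * C - E * C * D := by noncomm_ring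
      _ = _ := by rw [this]; noncomm_ring
  obtain ⟨e, he⟩ := hEu
  have hes : star (↑e⁻¹ : A) = ↑e⁻¹ := by
    have : star e = e := Units.ext (by simpa [he] using hEs)
    rw [← Units.coe_star_inv, this]
  let F : ℂ → A := fun z ↦ ↑e⁻¹ * (z • 1 + C) * Ring.inverse (1 + z • star C) * D
  have hu : ∀ z : ℂ, ‖z‖ ≤ 1 → IsUnit (1 + z • star C) := fun z hz ↦ by
    have := isUnit_one_sub_of_norm_lt_one (x := -(z • star C)) (by
      rw [norm_neg, norm_smul, norm_star]
      exact (mul_le_of_le_one_left (norm_nonneg _) hz).trans_lt hC)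
    simpa using this
  have hF0 : F 0 = C := by
    have : (↑e⁻¹ : A) * (C * D) = C := by rw [← hEC, ← he]; simp
    simpa [F, mul_assoc] using this
  have hdiff : ∀ z ∈ closure (Metric.ball (0 : ℂ) 1),
      DifferentiableAt ℂ (fun z ↦ Polynomial.aeval (F z) p) z := fun z hz ↦ by
    have hz : ‖z‖ ≤ 1 := by
      rw [closure_ball _ one_ne_zero] at hz; simpa using hz
    have h1 : DifferentiableAt ℂ (fun z : ℂ ↦ Ring.inverse (1 + z • star C)) z := by
      have h2 : DifferentiableAt ℂ Ring.inverse (1 + z • star C) := by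
        obtain ⟨u, h⟩ := hu z hz
        rw [← h]
        exact differentiableAt_inverse u.isUnit
      exact DifferentiableAt.comp (g := Ring.inverse) (f := fun z : ℂ ↦ 1 + z • star C) z h2
        (by fun_prop)
    have hF : DifferentiableAt ℂ F z := by
      refine ((DifferentiableAt.mul ?_ h1).mul_const D)
      fun_prop
    simp only [Polynomial.aeval_eq_sum_range]
    fun_prop
  have hU : ∀ z : ℂ, ‖z‖ = 1 → F z ∈ unitary A := fun z hz ↦ by
    have hzz : z * star z = 1 := by
      have := Complex.mul_conj z
      rw [Complex.normSq_eq_norm_sq, hz] at this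
      simpa using this
    obtain ⟨x, hx⟩ := (hu z hz.le).star
    have hX : (x : A) = 1 + star z • C := by simp [hx]
    have hsX : star (x : A) = 1 + z • star C := by simp [hX]
    have hF : F z = z • (↑e⁻¹ * x * star (↑x⁻¹ : A) * D) := by
      have h1 : Ring.inverse (1 + z • star C) = star (↑x⁻¹ : A) := by
        rw [← hsX, ← Units.coe_star, Ring.inverse_unit, ← Units.coe_star_inv]
      have h2 : z • (1 : A) + C = z • (x : A) := by rw [hX, smul_add, smul_smul, hzz, one_smul]
      simp only [F, h1, h2, mul_smul_comm, smul_mul_assoc]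
    have hm := moebius_mul_star_self (D := D) (E := E) x.mul_inv
      (by rw [hsX, hX, hD]
          simp only [mul_add, add_mul, smul_mul_smul_comm, hzz, one_smul, one_mul, mul_one]; abel)
      (by rw [hsX, hX, hE]
          simp only [mul_add, add_mul, smul_mul_smul_comm, mul_comm (star z), hzz, one_smul,
            one_mul, mul_one]; abel)
    have h1 : F z * star (F z) = 1 := by
      rw [hF]
      simp only [star_smul, star_mul, star_star, hDs, hes, smul_mul_smul_comm, hzz, one_smul]
      calc _ = (↑e⁻¹ : A) * (x * star (↑x⁻¹ : A) * D * D * ↑x⁻¹ * star (x : A)) * ↑e⁻¹ := by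
            simp only [mul_assoc]
        _ = 1 := by rw [hm, ← he]; simp
    have hFu : IsUnit (F z) := by
      have hz0 : IsUnit (algebraMap ℂ A z) :=
        (IsUnit.mk0 z (by rintro rfl; simp at hz)).map (algebraMap ℂ A)
      rw [hF, Algebra.smul_def]
      exact hz0.mul (((e⁻¹.isUnit.mul x.isUnit).mul x⁻¹.isUnit.star).mul hDu)
    refine Unitary.mem_iff.2 ⟨?_, h1⟩
    refine hFu.mul_left_cancel ?_
    rw [← mul_assoc, h1, one_mul, mul_one]
  have := Complex.norm_le_of_forall_mem_frontier_norm_le (U := Metric.ball (0 : ℂ) 1) (C := K)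
    (f := fun z ↦ Polynomial.aeval (F z) p) Metric.isBounded_ball
    (DifferentiableOn.diffContOnCl fun z hz ↦ (hdiff z hz).differentiableWithinAt)
    (fun z hz ↦ by
      rw [frontier_ball _ one_ne_zero] at hz
      exact norm_aeval_le_of_mem_unitary (hU z (by simpa using hz)) p hK)
    (z := 0) (subset_closure (by simp))
  simpa [hF0] using this

/-- **Von Neumann's inequality**. -/
theorem norm_aeval_le_of_norm_le_one {C : A} (hC : ‖C‖ ≤ 1) (p : Polynomial ℂ) {K : ℝ}
    (hK : ∀ z : ℂ, ‖z‖ ≤ 1 → ‖p.eval z‖ ≤ K) : ‖Polynomial.aeval C p‖ ≤ K := by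
  have hc : Continuous fun t : ℝ ↦ ‖Polynomial.aeval ((t : ℂ) • C) p‖ := by
    simp only [Polynomial.aeval_eq_sum_range]
    fun_prop
  have hlim : Filter.Tendsto (fun t : ℝ ↦ ‖Polynomial.aeval ((t : ℂ) • C) p‖)
      (nhdsWithin 1 (Set.Ioo 0 1)) (nhds ‖Polynomial.aeval C p‖) := by
    have := hc.tendsto 1
    simp only [Complex.ofReal_one, one_smul] at this
    exact this.mono_left nhdsWithin_le_nhds
  have : (nhdsWithin (1 : ℝ) (Set.Ioo 0 1)).NeBot := right_nhdsWithin_Ioo_neBot one_pos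
  refine le_of_tendsto hlim (Filter.eventually_of_mem self_mem_nhdsWithin fun t ht ↦ ?_)
  refine norm_aeval_le_of_norm_lt_one ?_ p hK
  rw [norm_smul, Complex.norm_real, Real.norm_of_nonneg ht.1.le]
  nlinarith [ht.1, ht.2, norm_nonneg C]

theorem half_le_of_mem_spectrum {R : A} (hR : 0 ≤ R) (hRu : IsUnit R)
    (h : R ≤ (2 : ℝ) • R ^ 2) {s : ℝ} (hs : s ∈ spectrum ℝ R) : 1 / 2 ≤ s := by
  have hRs := IsSelfAdjoint.of_nonneg hR
  have h1 : cfc (fun s : ℝ ↦ s) R ≤ cfc (fun s : ℝ ↦ 2 * s ^ 2) R := by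
    rwa [cfc_id' ℝ R, cfc_const_mul (2 : ℝ) (fun s ↦ s ^ 2) R, cfc_pow_id R 2]
  have h2 := (cfc_le_iff (fun s : ℝ ↦ s) (fun s ↦ 2 * s ^ 2) R).1 h1 s hs
  have h3 : 0 ≤ s := spectrum_nonneg_of_nonneg hR hs
  have h4 : s ≠ 0 := by
    rintro rfl
    exact spectrum.zero_notMem ℝ hRu hs
  have h5 : 0 < s := lt_of_le_of_ne h3 h4.symm
  by_contra hlt
  nlinarith

theorem norm_aeval_le_two_mul_of_fixed_point {N R : A} (hR : 0 ≤ R)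
    (h : (2 - star N * R * N) * R = 1) (p : Polynomial ℂ) {K : ℝ}
    (hK : ∀ z : ℂ, ‖z‖ ≤ 1 → ‖p.eval z‖ ≤ K) : ‖Polynomial.aeval N p‖ ≤ 2 * K := by
  have hRs := IsSelfAdjoint.of_nonneg hR
  have h' : R * (2 - star N * R * N) = 1 := by
    simpa [mul_assoc, hRs.star_eq] using congrArg star h
  let u : Aˣ := ⟨R, 2 - star N * R * N, h', h⟩
  have hsp : ∀ s ∈ spectrum ℝ R, 1 / 2 ≤ s := by
    refine fun s hs ↦ half_le_of_mem_spectrum hR u.isUnit ?_ hs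
    have h2 : R * (star N * R * N) * R = (2 : ℝ) • R ^ 2 - R := by
      have : R * (2 - star N * R * N) * R = R := by rw [h', one_mul]
      rw [mul_sub, sub_mul, sub_eq_iff_eq_add, ← sub_eq_iff_eq_add'] at this
      rw [← this, two_smul, pow_two]
      noncomm_ring
    rw [← sub_nonneg, ← h2]
    have := star_left_conjugate_nonneg hR (N * R)
    rw [star_mul, hRs.star_eq] at this
    simpa only [mul_assoc] using this
  set S := cfc (fun s : ℝ ↦ √(min s 2)) R with hS
  set S' := cfc (fun s : ℝ ↦ (√(min s 2))⁻¹) R with hS'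
  have hmin : ∀ s ∈ spectrum ℝ R, 1 / 2 ≤ min s 2 := fun s hs ↦ le_min (hsp s hs) (by norm_num)
  have hne : ∀ s ∈ spectrum ℝ R, √(min s 2) ≠ 0 := fun s hs ↦
    (Real.sqrt_pos.2 (by linarith [hmin s hs])).ne'
  have hci : ContinuousOn (fun s : ℝ ↦ (√(min s 2))⁻¹) (spectrum ℝ R) :=
    ContinuousOn.inv₀ (by fun_prop) hne
  have hSs : IsSelfAdjoint S := IsSelfAdjoint.cfc
  have hSs' : IsSelfAdjoint S' := IsSelfAdjoint.cfc
  have hSS' : S * S' = 1 := by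
    rw [hS, hS', ← cfc_mul (fun s : ℝ ↦ √(min s 2)) (fun s ↦ (√(min s 2))⁻¹) R (by fun_prop) hci,
      ← cfc_const_one ℝ R]
    exact cfc_congr fun s hs ↦ mul_inv_cancel₀ (hne s hs)
  have hS'S : S' * S = 1 := by
    simpa [hSs.star_eq, hSs'.star_eq] using congrArg star hSS'
  have hSn : ‖S‖ ≤ √2 := norm_cfc_le (Real.sqrt_nonneg _) fun s _ ↦ by
    rw [Real.norm_of_nonneg (Real.sqrt_nonneg _)]
    exact Real.sqrt_le_sqrt (min_le_right _ _)
  have hSn' : ‖S'‖ ≤ √2 := norm_cfc_le (Real.sqrt_nonneg _) fun s hs ↦ by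
    rw [← Real.sqrt_inv, Real.norm_of_nonneg (Real.sqrt_nonneg _)]
    refine Real.sqrt_le_sqrt ?_
    rw [inv_le_comm₀ (by linarith [hmin s hs]) two_pos]
    linarith [hmin s hs]
  have hSS : S * S = cfc (fun s : ℝ ↦ min s 2) R := by
    rw [hS, ← cfc_mul (fun s : ℝ ↦ √(min s 2)) (fun s ↦ √(min s 2)) R]
    exact cfc_congr fun s hs ↦ Real.mul_self_sqrt (by linarith [hmin s hs])
  have hle : star N * (S * S) * N ≤ S * S := by
    have h1 : S * S ≤ R := by
      rw [hSS]
      conv_rhs => rw [← cfc_id' ℝ R]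
      exact cfc_mono fun s _ ↦ min_le_left _ _
    have hinv : ContinuousOn (fun s : ℝ ↦ s⁻¹) (spectrum ℝ R) :=
      ContinuousOn.inv₀ (by fun_prop) fun s hs ↦ by linarith [hsp s hs]
    have h2 : star N * R * N = cfc (fun s : ℝ ↦ 2 - s⁻¹) R := by
      have h3 : cfc (fun s : ℝ ↦ s⁻¹) R = 2 - star N * R * N := cfc_inv_id (R := ℝ) u hRs
      rw [cfc_sub (fun _ ↦ (2 : ℝ)) (fun s ↦ s⁻¹) R continuousOn_const hinv, cfc_const (2 : ℝ) R,
        h3, map_ofNat, sub_sub_cancel]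
    calc star N * (S * S) * N ≤ star N * R * N := star_left_conjugate_le_conjugate h1 N
      _ ≤ S * S := by
        rw [h2, hSS]
        refine cfc_mono fun s hs ↦ le_min ?_ ?_
        · have : 0 < s := by linarith [hsp s hs]
          have h3 : s * s⁻¹ = 1 := mul_inv_cancel₀ this.ne'
          nlinarith [sq_nonneg (s - 1), inv_pos.2 this]
        · have : 0 < s := by linarith [hsp s hs]
          linarith [inv_pos.2 this]
  have hC : ‖S * N * S'‖ ≤ 1 := by
    have h1 : star (S * N * S') * (S * N * S') ≤ 1 := by
      have := star_left_conjugate_le_conjugate hle S'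
      calc _ = star S' * (star N * (S * S) * N) * S' := by
            simp only [star_mul, hSs.star_eq, mul_assoc]
        _ ≤ _ := this
        _ = (S' * S) * (S * S') := by simp only [hSs'.star_eq, mul_assoc]
        _ = 1 := by rw [hSS', hS'S, one_mul]
    have h2 := (CStarAlgebra.norm_le_one_iff_of_nonneg _ (star_mul_self_nonneg _)).2 h1
    rw [CStarRing.norm_star_mul_self] at h2
    nlinarith [norm_nonneg (S * N * S')]
  have hp : Polynomial.aeval N p = S' * Polynomial.aeval (S * N * S') p * S := by
    rw [mul_assoc, ← aeval_mul_eq_mul_aeval_of_mul_eq (S := S) (N := N) _ p, ← mul_assoc, hS'S,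
      one_mul]
    rw [mul_assoc, hS'S, mul_one]
  have hK0 : 0 ≤ K := (norm_nonneg _).trans (hK 0 (by simp))
  calc ‖Polynomial.aeval N p‖ ≤ ‖S'‖ * ‖Polynomial.aeval (S * N * S') p‖ * ‖S‖ := by
        rw [hp]; exact norm_mul₃_le
    _ ≤ √2 * K * √2 := by
        gcongr
        exact norm_aeval_le_of_norm_le_one hC p hK
    _ = 2 * K := by rw [mul_right_comm, Real.mul_self_sqrt two_pos.le]

theorem isStrictlyPositive_of_algebraMap_le {a : A} {r : ℝ} (hr : 0 < r)
    (h : algebraMap ℂ A r ≤ a) : IsStrictlyPositive a := by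
  refine IsStrictlyPositive.of_le ?_ h
  have : algebraMap ℂ A r = algebraMap ℝ A r := (IsScalarTower.algebraMap_apply ℝ ℂ A r).symm
  rw [this]
  exact isStrictlyPositive_algebraMap hr

end CStarAlgebra

section NumericalRange

variable {H : Type*} [NormedAddCommGroup H] [InnerProductSpace ℂ H]

open ZMod in
theorem sum_stdAddChar_mul_inner (T : H →L[ℂ] H) {N : ℕ} [NeZero N] (v : ZMod N → H)
    (m : ZMod N) :
    ∑ j : ZMod N, stdAddChar (-(j * m)) *
        ⟪∑ k, stdAddChar (j * k) • v k, T (∑ k, stdAddChar (j * k) • v k)⟫_ℂ =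
      N * ∑ l, ⟪v l, T (v (l + m))⟫_ℂ := by
  have h : ∀ j l k : ZMod N, stdAddChar (-(j * m)) *
      ⟪stdAddChar (j * l) • v l, stdAddChar (j * k) • T (v k)⟫_ℂ =
        stdAddChar (j * (k - (l + m))) * ⟪v l, T (v k)⟫_ℂ := fun j l k ↦ by
    rw [inner_smul_left, inner_smul_right, ← AddChar.map_neg_eq_conj, ← mul_assoc, ← mul_assoc,
      ← AddChar.map_add_eq_mul, ← AddChar.map_add_eq_mul]
    congr 2
    ring
  simp only [map_sum, _root_.map_smul, sum_inner, inner_sum, Finset.mul_sum, h]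
  rw [Finset.sum_comm]
  conv_lhs => enter [2, k]; rw [Finset.sum_comm]
  rw [Finset.sum_comm]
  refine Finset.sum_congr rfl fun l _ ↦ ?_
  simp only [← Finset.sum_mul, AddChar.sum_mulShift _ (isPrimitive_stdAddChar N), sub_eq_zero]
  simp

open ZMod in
theorem norm_sum_inner_cyclic_le {T : H →L[ℂ] H} {κ : ℝ}
    (hT : ∀ x, ‖⟪x, T x⟫_ℂ‖ ≤ κ * ‖x‖ ^ 2) {N : ℕ} [NeZero N] (v : ZMod N → H) :
    ‖∑ l, ⟪v l, T (v (l + 1))⟫_ℂ‖ ≤ κ * ∑ l, ‖v l‖ ^ 2 := by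
  have hN : (0 : ℝ) < N := Nat.cast_pos.2 (NeZero.pos N)
  set U : ZMod N → H := fun j ↦ ∑ k, stdAddChar (j * k) • v k
  have h0 : ∑ j, ‖U j‖ ^ 2 = N * ∑ l, ‖v l‖ ^ 2 := by
    have := sum_stdAddChar_mul_inner (ContinuousLinearMap.id ℂ H) v 0
    simp only [mul_zero, neg_zero, AddChar.map_zero_eq_one, one_mul, add_zero,
      ContinuousLinearMap.id_apply, inner_self_eq_norm_sq_to_K] at this
    exact Complex.ofReal_injective (by push_cast; exact this)
  have h1 := congrArg norm (sum_stdAddChar_mul_inner T v 1)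
  rw [norm_mul, Complex.norm_natCast] at h1
  refine le_of_mul_le_mul_left ?_ hN
  calc _ = _ := h1.symm
    _ ≤ ∑ j, κ * ‖U j‖ ^ 2 := by
      refine norm_sum_le_of_le _ fun j _ ↦ ?_
      rw [norm_mul, AddChar.norm_apply, one_mul]
      exact hT _
    _ = _ := by rw [← Finset.mul_sum, h0]; ring

theorem norm_sum_inner_succ_le {T : H →L[ℂ] H} {κ : ℝ}
    (hT : ∀ x, ‖⟪x, T x⟫_ℂ‖ ≤ κ * ‖x‖ ^ 2) (u : ℕ → H) (n : ℕ) :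
    ‖∑ i ∈ Finset.range n, ⟪u i, T (u (i + 1))⟫_ℂ‖ ≤
      κ * ∑ i ∈ Finset.range (n + 1), ‖u i‖ ^ 2 := by
  have h := norm_sum_inner_cyclic_le hT (N := n + 2)
    (fun k : Fin (n + 2) ↦ if k.val ≤ n then u k.val else 0)
  change ‖∑ l : Fin (n + 2), ⟪if l.val ≤ n then u l.val else 0,
    T (if (l + 1).val ≤ n then u (l + 1).val else 0)⟫_ℂ‖ ≤
      κ * ∑ l : Fin (n + 2), ‖if l.val ≤ n then u l.val else 0‖ ^ 2 at h
  rw [Fin.sum_univ_castSucc, Fin.sum_univ_castSucc, Fin.sum_univ_castSucc] at h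
  simp only [Fin.coeSucc_eq_succ, Fin.val_succ, Fin.val_castSucc, Fin.val_last, Fin.is_le,
    if_true, le_refl, Nat.not_succ_le_self, if_false, map_zero, inner_zero_left, inner_zero_right,
    add_zero, norm_zero, ne_eq, OfNat.ofNat_ne_zero, not_false_eq_true, zero_pow,
    Nat.succ_le_of_lt (Fin.is_lt _), (Fin.is_lt _).le] at h
  rwa [Fin.sum_univ_eq_sum_range (fun i ↦ ⟪u i, T (u (i + 1))⟫_ℂ) n,
    Fin.sum_univ_eq_sum_range (fun i ↦ ‖u i‖ ^ 2) (n + 1)] at h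

/-- The operator `(u₀, u₁, …) ↦ (T u₁, T u₂, …)` on square-summable sequences. -/
noncomputable def shiftMap (T : H →L[ℂ] H) :
    lp (fun _ : ℕ ↦ H) 2 →L[ℂ] lp (fun _ : ℕ ↦ H) 2 :=
  have hle : ∀ (u : lp (fun _ : ℕ ↦ H) 2) (i : ℕ),
      ‖T (u (i + 1))‖ ^ (2 : ENNReal).toReal ≤
        ‖T‖ ^ (2 : ENNReal).toReal * ‖u (i + 1)‖ ^ (2 : ENNReal).toReal := fun u i ↦ by
    rw [← Real.mul_rpow (norm_nonneg _) (norm_nonneg _)]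
    gcongr
    exact T.le_opNorm _
  have hsum : ∀ u : lp (fun _ : ℕ ↦ H) 2,
      Summable fun i ↦ ‖u (i + 1)‖ ^ (2 : ENNReal).toReal := fun u ↦
    (summable_nat_add_iff 1).2 ((lp.memℓp u).summable (by simp))
  have hT : ∀ u : lp (fun _ : ℕ ↦ H) 2, Summable fun i ↦ ‖T (u (i + 1))‖ ^ (2 : ENNReal).toReal :=
    fun u ↦ Summable.of_nonneg_of_le (fun i ↦ by positivity) (hle u) ((hsum u).mul_left _)
  LinearMap.mkContinuous
    { toFun := fun u ↦ ⟨fun i ↦ T (u (i + 1)), memℓp_gen (hT u)⟩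
      map_add' := fun u v ↦ by ext i; exact map_add T _ _
      map_smul' := fun a u ↦ by ext i; exact map_smul T _ _ }
    ‖T‖ fun u ↦ by
      refine lp.norm_le_of_tsum_le (by simp) (by positivity) ?_
      rw [Real.mul_rpow (norm_nonneg _) (norm_nonneg _), lp.norm_rpow_eq_tsum (by simp) u]
      calc _ ≤ ∑' i, ‖T‖ ^ (2 : ENNReal).toReal * ‖u (i + 1)‖ ^ (2 : ENNReal).toReal :=
            (hT u).tsum_le_tsum (hle u) ((hsum u).mul_left _)
        _ ≤ _ := by
          rw [tsum_mul_left]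
          refine mul_le_mul_of_nonneg_left ?_ (by positivity)
          exact (le_add_of_nonneg_left (by positivity)).trans_eq
            ((lp.memℓp u).summable (by simp)).tsum_eq_zero_add.symm

@[simp]
theorem shiftMap_apply (T : H →L[ℂ] H) (u : lp (fun _ : ℕ ↦ H) 2) (i : ℕ) :
    shiftMap T u i = T (u (i + 1)) := rfl

theorem norm_inner_shiftMap_le {T : H →L[ℂ] H} {κ : ℝ}
    (hT : ∀ x, ‖⟪x, T x⟫_ℂ‖ ≤ κ * ‖x‖ ^ 2) (u : lp (fun _ : ℕ ↦ H) 2) :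
    ‖⟪u, shiftMap T u⟫_ℂ‖ ≤ κ * ‖u‖ ^ 2 := by
  have h1 := (lp.hasSum_inner (𝕜 := ℂ) u (shiftMap T u)).tendsto_sum_nat.norm
  have h2 : HasSum (fun i ↦ ‖u i‖ ^ 2) (‖u‖ ^ 2) := by
    simpa using lp.hasSum_norm (p := 2) (by simp) u
  exact le_of_tendsto_of_tendsto' h1
    ((h2.tendsto_sum_nat.comp (Filter.tendsto_add_atTop_nat 1)).const_mul κ)
    fun n ↦ norm_sum_inner_succ_le hT u n

variable [CompleteSpace H]

theorem adjoint_shiftMap_apply_zero (T : H →L[ℂ] H) (u : lp (fun _ : ℕ ↦ H) 2) :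
    (shiftMap T).adjoint u 0 = 0 := by
  refine ext_inner_left ℂ fun x ↦ ?_
  refine (lp.inner_single_left (𝕜 := ℂ) 0 x ((shiftMap T).adjoint u)).symm.trans ?_
  rw [ContinuousLinearMap.adjoint_inner_right, inner_zero_right]
  have : shiftMap T (lp.single 2 0 x) = 0 := by ext i; simp
  rw [this, inner_zero_left]

theorem adjoint_shiftMap_apply_succ (T : H →L[ℂ] H) (u : lp (fun _ : ℕ ↦ H) 2) (i : ℕ) :
    (shiftMap T).adjoint u (i + 1) = T.adjoint (u i) := by
  refine ext_inner_left ℂ fun x ↦ ?_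
  refine (lp.inner_single_left (𝕜 := ℂ) (i + 1) x ((shiftMap T).adjoint u)).symm.trans ?_
  rw [ContinuousLinearMap.adjoint_inner_right]
  have : shiftMap T (lp.single 2 (i + 1) x) = lp.single 2 i (T x) := by
    ext j
    by_cases h : j = i
    · subst h; simp
    · simp [Pi.single_eq_of_ne, h]
  rw [this, ContinuousLinearMap.adjoint_inner_right]
  exact lp.inner_single_left (𝕜 := ℂ) (G := fun _ : ℕ ↦ H) i (T x) u

theorem exists_nonneg_fixed_point {T : H →L[ℂ] H} {κ : ℝ} (hκ : κ < 1)
    (hT : ∀ x, ‖⟪x, T x⟫_ℂ‖ ≤ κ * ‖x‖ ^ 2) :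
    ∃ R : H →L[ℂ] H, 0 ≤ R ∧ (2 - T * R * star T) * R = 1 := by
  set B := shiftMap T
  set J : H →L[ℂ] lp (fun _ : ℕ ↦ H) 2 :=
    lp.singleContinuousLinearMap ℂ (fun _ : ℕ ↦ H) 2 0
  have hJ : ∀ u, J.adjoint u = u 0 := fun u ↦ by
    refine ext_inner_left ℂ fun x ↦ ?_
    rw [ContinuousLinearMap.adjoint_inner_right]
    exact lp.inner_single_left (𝕜 := ℂ) 0 x u
  have hJ0 : ∀ x, J x 0 = x := fun x ↦ lp.single_apply_self (E := fun _ : ℕ ↦ H) 2 0 x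
  have hJs : ∀ x i, J x (i + 1) = 0 := fun x i ↦
    lp.single_apply_ne (E := fun _ : ℕ ↦ H) 2 0 x i.succ_ne_zero
  have hA : IsStrictlyPositive ((2 : lp (fun _ : ℕ ↦ H) 2 →L[ℂ] lp (fun _ : ℕ ↦ H) 2)
      + B + B.adjoint) := by
    have h1 : algebraMap ℂ (lp (fun _ : ℕ ↦ H) 2 →L[ℂ] lp (fun _ : ℕ ↦ H) 2) (2 - 2 * κ : ℝ) ≤
        2 + B + B.adjoint := by
      rw [ContinuousLinearMap.le_def]
      refine ⟨IsSelfAdjoint.isSymmetric ?_, fun u ↦ ?_⟩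
      · rw [add_assoc]
        exact ((IsSelfAdjoint.ofNat _).add (IsSelfAdjoint.add_star_self B)).sub
          (IsSelfAdjoint.algebraMap _ (Complex.conj_ofReal _))
      · have h2 : (2 + B + B.adjoint - algebraMap ℂ _ (2 - 2 * κ : ℝ)) u =
            B u + B.adjoint u + ((2 * κ : ℝ) : ℂ) • u := by
          have h3 : (2 + B + B.adjoint) u = (2 : ℂ) • u + B u + B.adjoint u := by
            have h4 : (2 : lp (fun _ : ℕ ↦ H) 2 →L[ℂ] lp (fun _ : ℕ ↦ H) 2) = 1 + 1 :=
              one_add_one_eq_two.symm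
            rw [two_smul, h4]
            rfl
          rw [sub_apply, h3, Algebra.algebraMap_eq_smul_one]
          change _ - ((2 - 2 * κ : ℝ) : ℂ) • u = _
          rw [Complex.ofReal_sub, sub_smul, Complex.ofReal_ofNat]
          abel
        have h5 := norm_inner_shiftMap_le hT u
        have h6 := (abs_le.1 ((Complex.abs_re_le_norm _).trans h5)).1
        have h7 : (⟪B u, u⟫_ℂ).re = (⟪u, B u⟫_ℂ).re := inner_re_symm (𝕜 := ℂ) _ _
        have h8 : (⟪((2 * κ : ℝ) : ℂ) • u, u⟫_ℂ).re = 2 * κ * ‖u‖ ^ 2 := by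
          rw [inner_smul_left, Complex.conj_ofReal, Complex.re_ofReal_mul, inner_self_eq_norm_sq_to_K]
          norm_cast
        rw [ContinuousLinearMap.reApplyInnerSelf_apply, h2, inner_add_left, inner_add_left,
          ContinuousLinearMap.adjoint_inner_left]
        change 0 ≤ (⟪B u, u⟫_ℂ + ⟪u, B u⟫_ℂ + ⟪((2 * κ : ℝ) : ℂ) • u, u⟫_ℂ).re
        rw [Complex.add_re, Complex.add_re, h7, h8]
        linarith
    exact isStrictlyPositive_of_algebraMap_le (by linarith) h1
  obtain ⟨a, ha⟩ := hA.isUnit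
  have ha0 : 0 ≤ (↑a⁻¹ : lp (fun _ : ℕ ↦ H) 2 →L[ℂ] lp (fun _ : ℕ ↦ H) 2) := by
    have hs : star (↑a⁻¹ : lp (fun _ : ℕ ↦ H) 2 →L[ℂ] lp (fun _ : ℕ ↦ H) 2) = ↑a⁻¹ := by
      have : star a = a := Units.ext (by simpa [ha] using hA.isSelfAdjoint.star_eq)
      rw [← Units.coe_star_inv, this]
    have := star_left_conjugate_nonneg (ha ▸ hA.nonneg : 0 ≤ a.val)
      (↑a⁻¹ : lp (fun _ : ℕ ↦ H) 2 →L[ℂ] lp (fun _ : ℕ ↦ H) 2)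
    rwa [hs, a.inv_mul, one_mul] at this
  have hRx : ∀ x u, a.val u = J x → u 0 = (J.adjoint ∘L ↑a⁻¹ ∘L J) x := fun x u h ↦ by
    have : u = (a⁻¹).val (J x) := by
      rw [← h, ← mul_apply_eq_comp, a.inv_mul, one_apply_eq_self]
    rw [← hJ, this]
    rfl
  have hau : ∀ u, a.val u = (2 : ℂ) • u + B u + B.adjoint u := fun u ↦ by
    
    have h2 : (2 : lp (fun _ : ℕ ↦ H) 2 →L[ℂ] lp (fun _ : ℕ ↦ H) 2) = 1 + 1 :=
      one_add_one_eq_two.symm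
    rw [ha, two_smul, h2]
    rfl
  refine ⟨J.adjoint ∘L ↑a⁻¹ ∘L J, ?_, ?_⟩
  · rw [ContinuousLinearMap.nonneg_iff_isPositive] at ha0 ⊢
    exact ha0.adjoint_conj J
  ext x
  set R := J.adjoint ∘L ↑a⁻¹ ∘L J
  set u := (a⁻¹).val (J x)
  have hu : a.val u = J x := by
    rw [← mul_apply_eq_comp, a.mul_inv, one_apply_eq_self]
  set w := shiftMap (ContinuousLinearMap.id ℂ H) u
  have hw : a.val w = J (-(T.adjoint (u 0))) := by
    ext i
    have h1 : (2 : ℂ) • u (i + 1) + T (u (i + 2)) + B.adjoint u (i + 1) = J x (i + 1) := by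
      rw [← hu, hau]; rfl
    rw [adjoint_shiftMap_apply_succ, hJs] at h1
    rw [hau]
    change (2 : ℂ) • u (i + 1) + T (u (i + 2)) + B.adjoint w i = _
    rw [eq_neg_of_add_eq_zero_left h1]
    cases i with
    | zero =>
      rw [adjoint_shiftMap_apply_zero, add_zero, hJ0]
    | succ i =>
      rw [adjoint_shiftMap_apply_succ, hJs]
      exact neg_add_cancel _
  have h0 : (2 : ℂ) • u 0 + T (u 1) = x := by
    have h1 : (2 : ℂ) • u 0 + T (u 1) + B.adjoint u 0 = J x 0 := by
      rw [← hu, hau]; rfl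
    rw [adjoint_shiftMap_apply_zero, add_zero, hJ0] at h1
    exact h1
  have h1 : u 1 = R (-(T.adjoint (u 0))) := hRx _ _ hw
  rw [h1, hRx _ _ hu, map_neg, map_neg, ← sub_eq_add_neg, two_smul] at h0
  rw [← one_add_one_eq_two]
  exact h0

open Polynomial in
theorem norm_aeval_le_two_mul_of_norm_inner_le {T : H →L[ℂ] H} {κ : ℝ} (hκ : κ < 1)
    (hT : ∀ x, ‖⟪x, T x⟫_ℂ‖ ≤ κ * ‖x‖ ^ 2) (p : ℂ[X]) {K : ℝ}
    (hK : ∀ z : ℂ, ‖z‖ ≤ 1 → ‖p.eval z‖ ≤ K) : ‖aeval T p‖ ≤ 2 * K := by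
  obtain ⟨R, hR, h⟩ := exists_nonneg_fixed_point (T := star T) hκ fun x ↦ by
    rw [ContinuousLinearMap.star_eq_adjoint, ContinuousLinearMap.adjoint_inner_right,
      norm_inner_symm]
    exact hT x
  rw [star_star] at h
  exact norm_aeval_le_two_mul_of_fixed_point hR h p hK

end NumericalRange

/-- **Theorem (Okubo–Ando).** If the closure of the numerical range of a
bounded operator `M` on a complex Hilbert space is contained in the open disk
of center `c` and radius `r`, then `2` is a spectral constant:
`‖p(M)‖ ≤ 2 sup_{|z − c| ≤ r} |p(z)|` for every polynomial `p`. -/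
theorem stmt_14 {H : Type*} [NormedAddCommGroup H] [InnerProductSpace ℂ H]
    [CompleteSpace H] (M : H →L[ℂ] H) (c : ℂ) (r : ℝ) (hr : 0 < r)
    (hW : closure {z : ℂ | ∃ x : H, ‖x‖ = 1 ∧ ⟪x, M x⟫_ℂ = z} ⊆ Metric.ball c r) :
    ∀ p : Polynomial ℂ,
      ‖Polynomial.aeval M p‖ ≤ 2 * ⨆ z : Metric.closedBall c r, ‖p.eval (z : ℂ)‖ := by
  intro p
  obtain ⟨s, hsr, hs⟩ := exists_lt_subset_ball isClosed_closure hW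
  have hr' : (r : ℂ) ≠ 0 := Complex.ofReal_ne_zero.2 hr.ne'
  set T : H →L[ℂ] H := (r : ℂ)⁻¹ • (M - algebraMap ℂ (H →L[ℂ] H) c)
  have hM : M = (r : ℂ) • T + algebraMap ℂ (H →L[ℂ] H) c := by
    rw [smul_inv_smul₀ hr', sub_add_cancel]
  have hT1 : ∀ x : H, ‖x‖ = 1 → ‖⟪x, T x⟫_ℂ‖ ≤ s / r := fun x hx ↦ by
    have h1 := hs (subset_closure ⟨x, hx, rfl⟩)
    have h2 : ⟪x, T x⟫_ℂ = (r : ℂ)⁻¹ * (⟪x, M x⟫_ℂ - c) := by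
      change ⟪x, (r : ℂ)⁻¹ • (M x - c • x)⟫_ℂ = _
      rw [inner_smul_right, inner_sub_right, inner_smul_right, inner_self_eq_norm_sq_to_K, hx]
      simp
    rw [Metric.mem_ball, dist_eq_norm] at h1
    rw [h2, norm_mul, norm_inv, Complex.norm_real, Real.norm_of_nonneg hr.le, inv_mul_eq_div]
    gcongr
  have hT : ∀ x : H, ‖⟪x, T x⟫_ℂ‖ ≤ s / r * ‖x‖ ^ 2 := fun x ↦ by
    rcases eq_or_ne x 0 with rfl | hx
    · simp
    have h1 := hT1 (((‖x‖ : ℂ)⁻¹) • x) (norm_smul_inv_norm hx)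
    rw [map_smul, inner_smul_left, inner_smul_right, ← mul_assoc, norm_mul, norm_mul,
      RCLike.norm_conj, norm_inv, Complex.norm_real, norm_norm, ← mul_inv, inv_mul_eq_div,
      div_le_iff₀ (by positivity), ← pow_two] at h1
    exact h1
  set q : Polynomial ℂ := p.comp (Polynomial.C (r : ℂ) * Polynomial.X + Polynomial.C c)
  have hq : Polynomial.aeval T q = Polynomial.aeval M p := by
    rw [Polynomial.aeval_comp]
    congr 1
    rw [hM]
    simp [Algebra.smul_def]
  have hbdd : BddAbove (Set.range fun z : Metric.closedBall c r ↦ ‖p.eval (z : ℂ)‖) := by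
    have := (isCompact_closedBall c r).bddAbove_image (f := fun z ↦ ‖p.eval z‖)
      p.continuous.norm.continuousOn
    rwa [Set.image_eq_range] at this
  rw [← hq]
  refine norm_aeval_le_two_mul_of_norm_inner_le ((div_lt_one hr).2 hsr) hT q fun z hz ↦ ?_
  have hmem : (r : ℂ) * z + c ∈ Metric.closedBall c r := by
    rw [mem_closedBall_iff_norm, add_sub_cancel_right, norm_mul, Complex.norm_real,
      Real.norm_of_nonneg hr.le]
    exact mul_le_of_le_one_right hr.le hz
  have := le_ciSup hbdd ⟨_, hmem⟩
  simpa [q] using this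
end

section
/- (von Neumann) Let r > 0 and let M be a bounded linear operator on a complex Hilbert space H with ‖M‖ < r. Then for every polynomial p ∈ ℂ[X], ‖p(M)‖ ≤ sup_{|z| ≤ r} |p(z)|. -/
open Polynomial Filter Topology

/-- A polynomial in a unitary element of a C⋆-algebra is bounded by any bound for the polynomial
on the unit circle. -/
lemma norm_aeval_le_of_mem_unitary_s15 {A : Type*} [CStarAlgebra A] {u : A} (hu : u ∈ unitary A)
    (p : ℂ[X]) {C : ℝ} (hC : 0 ≤ C) (h : ∀ z : ℂ, ‖z‖ = 1 → ‖p.eval z‖ ≤ C) :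
    ‖aeval u p‖ ≤ C := by
  have : IsStarNormal u :=
    ⟨(Unitary.star_mul_self_of_mem hu).trans (Unitary.mul_star_self_of_mem hu).symm⟩
  rw [← cfc_polynomial p u]
  refine norm_cfc_le hC fun z hz => h z ?_
  simpa using spectrum.subset_circle_of_unitary hu hz

section Dilation

variable {H : Type*} [NormedAddCommGroup H] [InnerProductSpace ℂ H]

/-- A contraction `T` has a defect operator. -/
lemma exists_norm_sq_eq_sub_of_norm_le_one [CompleteSpace H] (T : H →L[ℂ] H) (hT : ‖T‖ ≤ 1) :
    ∃ D : H →L[ℂ] H, ∀ x, ‖D x‖ ^ 2 = ‖x‖ ^ 2 - ‖T x‖ ^ 2 := by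
  have hpos : 0 ≤ 1 - star T * T := by
    rw [sub_nonneg]
    refine CStarAlgebra.star_mul_le_algebraMap_norm_sq.trans ?_
    rw [← map_one (algebraMap ℝ (H →L[ℂ] H))]
    exact algebraMap_mono _ (pow_le_one₀ (norm_nonneg _) hT)
  obtain ⟨D, hD⟩ := CStarAlgebra.nonneg_iff_eq_star_mul_self.mp hpos
  refine ⟨D, fun x => ?_⟩
  have key (S : H →L[ℂ] H) : ‖S x‖ ^ 2 = (inner ℂ ((star S * S) x) x).re := by
    simpa [ContinuousLinearMap.star_eq_adjoint] using
      ContinuousLinearMap.apply_norm_sq_eq_inner_adjoint_left S x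
  rw [key D, key T, ← hD, sub_apply, inner_sub_left, Complex.sub_re,
    one_apply_eq_self, ← inner_self_eq_norm_sq (𝕜 := ℂ)]
  rfl

/-- The cyclic backward shift on `Hⁿ`. -/
noncomputable def cyclicShift (H : Type*) [NormedAddCommGroup H] [InnerProductSpace ℂ H] (n : ℕ) :
    PiLp 2 (fun _ : Fin n => H) ≃ₗᵢ[ℂ] PiLp 2 (fun _ : Fin n => H) :=
  LinearIsometryEquiv.piLpCongrLeft 2 ℂ H (finRotate n).symm

lemma cyclicShift_apply {n : ℕ} (f : PiLp 2 (fun _ : Fin n => H)) (i : Fin n) :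
    cyclicShift H n f i = f (finRotate n i) := rfl

/-- The cyclic backward shift as a bounded operator. -/
noncomputable def cyclicShiftCLM (H : Type*) [NormedAddCommGroup H] [InnerProductSpace ℂ H]
    (n : ℕ) : PiLp 2 (fun _ : Fin n => H) →L[ℂ] PiLp 2 (fun _ : Fin n => H) :=
  (cyclicShift H n).toContinuousLinearEquiv

lemma cyclicShiftCLM_mem_unitary [CompleteSpace H] (n : ℕ) :
    cyclicShiftCLM H n ∈ unitary (PiLp 2 (fun _ : Fin n => H) →L[ℂ] PiLp 2 (fun _ : Fin n => H)) :=
  (Unitary.linearIsometryEquiv.symm (cyclicShift H n)).2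

lemma cyclicShiftCLM_pow_apply {n k : ℕ} (f : PiLp 2 (fun _ : Fin n => H)) {i : ℕ}
    (hi : i + k < n) :
    (cyclicShiftCLM H n ^ k) f ⟨i, by lia⟩ = f ⟨i + k, hi⟩ := by
  induction k generalizing f with
  | zero => rfl
  | succ k ih =>
    rw [pow_succ, mul_apply_eq_comp, ih _ (by lia)]
    change cyclicShift H n f _ = _
    obtain ⟨n, rfl⟩ := Nat.exists_eq_succ_of_ne_zero (show n ≠ 0 by lia)
    rw [cyclicShift_apply, finRotate_of_lt (by lia)]
    rfl

lemma sum_norm_sq_defect {T D : H →L[ℂ] H} (hD : ∀ x, ‖D x‖ ^ 2 = ‖x‖ ^ 2 - ‖T x‖ ^ 2)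
    (x : H) (n : ℕ) :
    ∑ i ∈ Finset.range n, ‖D ((T ^ i) x)‖ ^ 2 = ‖x‖ ^ 2 - ‖(T ^ n) x‖ ^ 2 := by
  simp_rw [hD, ← mul_apply_eq_comp, ← pow_succ']
  simpa using Finset.sum_range_sub' (fun i => ‖(T ^ i) x‖ ^ 2) n

/-- The values of `p(T)` at `x`, up to a tail, are dominated through the truncated dilation. -/
lemma norm_sq_aeval_apply_sub_le [CompleteSpace H] (T : H →L[ℂ] H) (hT : ‖T‖ ≤ 1) (p : ℂ[X])
    {C : ℝ} (hC : 0 ≤ C) (h : ∀ z : ℂ, ‖z‖ = 1 → ‖p.eval z‖ ≤ C) (x : H) (L : ℕ) :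
    ‖aeval T p x‖ ^ 2 - ‖(T ^ L) (aeval T p x)‖ ^ 2 ≤ C ^ 2 * ‖x‖ ^ 2 := by
  obtain ⟨D, hD⟩ := exists_norm_sq_eq_sub_of_norm_le_one T hT
  set n := L + p.natDegree
  set v : PiLp 2 (fun _ : Fin n => H) := WithLp.toLp 2 fun i => D ((T ^ (i : ℕ)) x)
  have hvnorm : ‖v‖ ^ 2 ≤ ‖x‖ ^ 2 := by
    rw [PiLp.norm_sq_eq_of_L2]
    change ∑ i : Fin n, ‖D ((T ^ (i : ℕ)) x)‖ ^ 2 ≤ _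
    rw [Fin.sum_univ_eq_sum_range (fun i => ‖D ((T ^ i) x)‖ ^ 2), sum_norm_sq_defect hD]
    linarith [sq_nonneg ‖(T ^ n) x‖]
  set w := aeval (cyclicShiftCLM H n) p v with hw
  have hwnorm : ‖w‖ ≤ C * ‖v‖ := (ContinuousLinearMap.le_opNorm _ _).trans <|
    mul_le_mul_of_nonneg_right
      (norm_aeval_le_of_mem_unitary_s15 (cyclicShiftCLM_mem_unitary n) p hC h) (norm_nonneg _)
  have hcoord (i : ℕ) (hi : i < L) :
      w ⟨i, by lia⟩ = D ((T ^ i) (aeval T p x)) := by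
    rw [hw, aeval_eq_sum_range, aeval_eq_sum_range]
    simp only [sum_apply, smul_apply, map_sum, map_smul,
      WithLp.ofLp_sum, Finset.sum_apply, PiLp.smul_apply]
    refine Finset.sum_congr rfl fun k hk => ?_
    rw [Finset.mem_range] at hk
    rw [cyclicShiftCLM_pow_apply v (by lia), ← mul_apply_eq_comp (T ^ i), ← pow_add]
  rw [← sum_norm_sq_defect hD]
  calc ∑ i ∈ Finset.range L, ‖D ((T ^ i) (aeval T p x))‖ ^ 2
      = ∑ i : Fin L, ‖w (Fin.castLE (Nat.le_add_right _ _) i)‖ ^ 2 := by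
        rw [← Fin.sum_univ_eq_sum_range (fun i => ‖D ((T ^ i) (aeval T p x))‖ ^ 2)]
        exact Finset.sum_congr rfl fun i _ => by rw [← hcoord i i.2]; rfl
    _ ≤ ∑ i : Fin n, ‖w i‖ ^ 2 := by
        refine (Finset.sum_map Finset.univ (Fin.castLEEmb (Nat.le_add_right _ _))
          (fun i => ‖w i‖ ^ 2)).symm.trans_le ?_
        exact Finset.sum_le_univ_sum_of_nonneg fun i => sq_nonneg _
    _ = ‖w‖ ^ 2 := (PiLp.norm_sq_eq_of_L2 _ w).symm
    _ ≤ (C * ‖v‖) ^ 2 := pow_le_pow_left₀ (norm_nonneg _) hwnorm 2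
    _ ≤ C ^ 2 * ‖x‖ ^ 2 := by
        rw [mul_pow]
        exact mul_le_mul_of_nonneg_left hvnorm (sq_nonneg C)

/-- Von Neumann's inequality for strict contractions. -/
lemma norm_aeval_le_of_norm_lt_one_s15 [CompleteSpace H] (T : H →L[ℂ] H) (hT : ‖T‖ < 1) (p : ℂ[X])
    {C : ℝ} (hC : 0 ≤ C) (h : ∀ z : ℂ, ‖z‖ = 1 → ‖p.eval z‖ ≤ C) : ‖aeval T p‖ ≤ C := by
  refine ContinuousLinearMap.opNorm_le_bound _ hC fun x => ?_
  have hpow : Tendsto (fun L : ℕ => (T ^ L) (aeval T p x)) atTop (𝓝 0) := by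
    have := ((ContinuousLinearMap.apply ℂ H (aeval T p x)).continuous.tendsto 0).comp
      (tendsto_pow_atTop_nhds_zero_of_norm_lt_one hT)
    rwa [map_zero] at this
  have hlim : Tendsto (fun L : ℕ => ‖aeval T p x‖ ^ 2 - ‖(T ^ L) (aeval T p x)‖ ^ 2) atTop
      (𝓝 (‖aeval T p x‖ ^ 2)) := by
    simpa using tendsto_const_nhds.sub (hpow.norm.pow 2)
  refine le_of_sq_le_sq ?_ (by positivity)
  rw [mul_pow]
  exact le_of_tendsto' hlim fun L => norm_sq_aeval_apply_sub_le T hT.le p hC h x L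

end Dilation


/-- **Theorem (von Neumann's inequality).** If `M` is a bounded operator on a
complex Hilbert space with `‖M‖ < r`, then
`‖p(M)‖ ≤ sup_{|z| ≤ r} |p(z)|` for every polynomial `p`. -/
theorem stmt_15 {H : Type*} [NormedAddCommGroup H] [InnerProductSpace ℂ H]
    [CompleteSpace H] (M : H →L[ℂ] H) (r : ℝ) (hr : 0 < r) (hM : ‖M‖ < r) :
    ∀ p : Polynomial ℂ,
      ‖Polynomial.aeval M p‖ ≤ ⨆ z : Metric.closedBall (0 : ℂ) r, ‖p.eval (z : ℂ)‖ := by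
  intro p
  have hbdd : BddAbove (Set.range fun z : Metric.closedBall (0 : ℂ) r => ‖p.eval (z : ℂ)‖) := by
    have : CompactSpace (Metric.closedBall (0 : ℂ) r) :=
      isCompact_iff_compactSpace.mp (isCompact_closedBall 0 r)
    exact (isCompact_range (by fun_prop)).bddAbove
  have hr' : (r : ℂ) ≠ 0 := by exact_mod_cast hr.ne'
  have hT : ‖(r : ℂ)⁻¹ • M‖ < 1 := by
    rw [norm_smul, norm_inv, Complex.norm_real, Real.norm_of_nonneg hr.le, inv_mul_lt_one₀ hr]
    exact hM
  have hcomp : aeval M p = aeval ((r : ℂ)⁻¹ • M) (p.comp (C (r : ℂ) * X)) := by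
    rw [aeval_comp, map_mul, aeval_C, aeval_X, ← Algebra.smul_def, smul_inv_smul₀ hr']
  rw [hcomp]
  refine norm_aeval_le_of_norm_lt_one_s15 _ hT _ (Real.iSup_nonneg fun _ => norm_nonneg _)
    fun z hz => ?_
  have hmem : (r : ℂ) * z ∈ Metric.closedBall (0 : ℂ) r := by
    simp [hz, abs_of_pos hr]
  simpa using le_ciSup hbdd ⟨_, hmem⟩
end

section
/- Let M be a bounded linear operator on a complex Hilbert space H, let r > 0 with ‖M‖ < r, and let σ ∈ ℂ with |σ| = r. Then the operator σ·Id − M is invertible in L(H), and with R := (σ·Id − M)⁻¹ one has σ·R + (σ·R)* − Id = R* ∘ (r²·Id − M* M) ∘ R; moreover this operator is positive, i.e. it is self-adjoint and ⟨(σ·R + (σ·R)* − Id)x, x⟩ ≥ 0 for all x ∈ H. -/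
open scoped InnerProductSpace

/-- **Positivity of the double-layer potential on a disk.** Let `M` be a
bounded operator on a complex Hilbert space `H` with `‖M‖ < r` and let
`σ ∈ ℂ` with `|σ| = r`. Then `σ·Id − M` is invertible, and its (two-sided)
inverse `R` satisfies
`σR + (σR)* − Id = R* (r²·Id − M*M) R`; moreover this operator is positive,
i.e. self-adjoint with `⟨(σR + (σR)* − Id)x, x⟩ ≥ 0` for all `x ∈ H`. -/
theorem stmt_16 {H : Type*} [NormedAddCommGroup H] [InnerProductSpace ℂ H]
    [CompleteSpace H] (M : H →L[ℂ] H) (r : ℝ) (hM : ‖M‖ < r)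
    (σ : ℂ) (hσ : ‖σ‖ = r) :
    IsUnit (σ • (1 : H →L[ℂ] H) - M) ∧
    ∀ R : H →L[ℂ] H,
      R * (σ • (1 : H →L[ℂ] H) - M) = 1 → (σ • (1 : H →L[ℂ] H) - M) * R = 1 →
      (σ • R + ContinuousLinearMap.adjoint (σ • R) - 1 =
          ContinuousLinearMap.adjoint R *
            (((r : ℂ) ^ 2) • (1 : H →L[ℂ] H) -
              ContinuousLinearMap.adjoint M * M) * R ∧
        IsSelfAdjoint (σ • R + ContinuousLinearMap.adjoint (σ • R) - 1) ∧
        ∀ x : H,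
          0 ≤ (⟪x, (σ • R + ContinuousLinearMap.adjoint (σ • R) - 1) x⟫_ℂ).re) := by
  have hunit : IsUnit (σ • (1 : H →L[ℂ] H) - M) := by
    have h : σ ∈ resolventSet ℂ M := by
      apply spectrum.mem_resolventSet_of_norm_lt_mul
      calc ‖M‖ * ‖(1 : H →L[ℂ] H)‖ ≤ ‖M‖ * 1 := by
            gcongr
            exact ContinuousLinearMap.norm_id_le
        _ < ‖σ‖ := by rw [mul_one, hσ]; exact hM
    simpa [spectrum.mem_resolventSet_iff, Algebra.algebraMap_eq_smul_one] using h
  refine ⟨hunit, fun R _ hR => ?_⟩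
  have hσR : σ • R = 1 + M * R := by
    rw [sub_mul, smul_mul_assoc, one_mul, sub_eq_iff_eq_add] at hR
    exact hR
  have hσσ : star σ * σ = (r : ℂ) ^ 2 := by
    rw [← hσ]
    exact Complex.conj_mul' σ
  have hid : σ • R + ContinuousLinearMap.adjoint (σ • R) - 1 =
      ContinuousLinearMap.adjoint R *
        (((r : ℂ) ^ 2) • (1 : H →L[ℂ] H) - ContinuousLinearMap.adjoint M * M) * R := by
    simp only [← ContinuousLinearMap.star_eq_adjoint]
    have hexp : star R * (((r : ℂ) ^ 2) • (1 : H →L[ℂ] H) - star M * M) * R =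
        star (σ • R) * (σ • R) - star (M * R) * (M * R) := by
      rw [star_smul, smul_mul_smul_comm, hσσ, star_mul]
      simp only [mul_sub, sub_mul, mul_smul_comm, smul_mul_assoc, mul_one, mul_assoc]
    rw [hexp, hσR, star_add, star_one]
    noncomm_ring
  refine ⟨hid, ?_, fun x => ?_⟩
  · rw [← ContinuousLinearMap.star_eq_adjoint]
    exact (IsSelfAdjoint.add_star_self _).sub (.one _)
  · have hre : (⟪x, (ContinuousLinearMap.adjoint R *
        (((r : ℂ) ^ 2) • (1 : H →L[ℂ] H) - ContinuousLinearMap.adjoint M * M) * R) x⟫_ℂ).re =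
        r ^ 2 * ‖R x‖ ^ 2 - ‖M (R x)‖ ^ 2 := by
      simp only [mul_assoc, mul_apply_eq_comp, ContinuousLinearMap.adjoint_inner_right,
        sub_apply, smul_apply,
        one_apply_eq_self, inner_sub_right, inner_smul_right,
        inner_self_eq_norm_sq_to_K, Complex.coe_algebraMap]
      norm_cast
    rw [hid, hre, sub_nonneg, ← mul_pow]
    gcongr
    exact (M.le_opNorm _).trans (by gcongr)
end
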